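/- Let ζ be an extremal number. Then w_{3,3}(ζ) = w_{3,4}(ζ) = ŵ_{3,2}(ζ) = 3 and λ_{3,3}(ζ) = λ_{3,4}(ζ) = λ̂_{3,2}(ζ) = 1/3. -/

import Mathlib

open Polynomial

/-- Height of an integer polynomial: the maximum absolute value of its coefficients. -/
noncomputable def polyH (P : Polynomial ℤ) : ℝ :=
  (((P.support.sup fun i => (P.coeff i).natAbs) : ℕ) : ℝ)

/-- Evaluation of an integer polynomial at a real number. -/
noncomputable def pev (ζ : ℝ) (P : Polynomial ℤ) : ℝ := Polynomial.aeval ζ P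

/-- Set of exponents η such that for arbitrarily large X the system
    H(P) ≤ X, 0 < |P(ζ)| ≤ X^(−η) has a solution of degree at most n. -/
def wSet (n : ℕ) (ζ : ℝ) : Set ℝ :=
  {η | ∀ X₀ : ℝ, ∃ X : ℝ, X₀ ≤ X ∧ ∃ P : Polynomial ℤ,
    P.natDegree ≤ n ∧ polyH P ≤ X ∧ 0 < |pev ζ P| ∧ |pev ζ P| ≤ X ^ (-η)}

/-- The exponent w_n(ζ). -/
noncomputable def wExp (n : ℕ) (ζ : ℝ) : ℝ := sSup (wSet n ζ)

/-- Set of exponents η such that for all sufficiently large X the system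
    H(P) ≤ X, 0 < |P(ζ)| ≤ X^(−η) has a solution of degree at most n. -/
def whSet (n : ℕ) (ζ : ℝ) : Set ℝ :=
  {η | ∃ X₀ : ℝ, ∀ X : ℝ, X₀ ≤ X → ∃ P : Polynomial ℤ,
    P.natDegree ≤ n ∧ polyH P ≤ X ∧ 0 < |pev ζ P| ∧ |pev ζ P| ≤ X ^ (-η)}

/-- The uniform exponent ŵ_n(ζ). -/
noncomputable def whExp (n : ℕ) (ζ : ℝ) : ℝ := sSup (whSet n ζ)

/-- Set of exponents η such that for arbitrarily large X the system
    |x| ≤ X, max_{1≤i≤n} |ζ^i x − y_i| ≤ X^(−η) has a nonzero integer solution. -/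
def lamSet (n : ℕ) (ζ : ℝ) : Set ℝ :=
  {η | ∀ X₀ : ℝ, ∃ X : ℝ, X₀ ≤ X ∧ ∃ x : ℤ, ∃ y : Fin n → ℤ,
    (x ≠ 0 ∨ y ≠ 0) ∧ ((|x| : ℤ) : ℝ) ≤ X ∧
    ∀ i : Fin n, |ζ ^ ((i : ℕ) + 1) * (x : ℝ) - (y i : ℝ)| ≤ X ^ (-η)}

/-- The exponent λ_n(ζ). -/
noncomputable def lamExp (n : ℕ) (ζ : ℝ) : ℝ := sSup (lamSet n ζ)

/-- Set of exponents η such that for all sufficiently large X the system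
    |x| ≤ X, max_{1≤i≤n} |ζ^i x − y_i| ≤ X^(−η) has a nonzero integer solution. -/
def lamhSet (n : ℕ) (ζ : ℝ) : Set ℝ :=
  {η | ∃ X₀ : ℝ, ∀ X : ℝ, X₀ ≤ X → ∃ x : ℤ, ∃ y : Fin n → ℤ,
    (x ≠ 0 ∨ y ≠ 0) ∧ ((|x| : ℤ) : ℝ) ≤ X ∧
    ∀ i : Fin n, |ζ ^ ((i : ℕ) + 1) * (x : ℝ) - (y i : ℝ)| ≤ X ^ (-η)}

/-- The uniform exponent λ̂_n(ζ). -/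
noncomputable def lamhExp (n : ℕ) (ζ : ℝ) : ℝ := sSup (lamhSet n ζ)

/-- Set of exponents η such that for arbitrarily large X the polynomial system has
    at least j linearly independent solutions of degree at most n. -/
def wSetJ (n j : ℕ) (ζ : ℝ) : Set ℝ :=
  {η | ∀ X₀ : ℝ, ∃ X : ℝ, X₀ ≤ X ∧ ∃ P : Fin j → Polynomial ℤ,
    LinearIndependent ℤ P ∧ ∀ i : Fin j,
      (P i).natDegree ≤ n ∧ polyH (P i) ≤ X ∧ 0 < |pev ζ (P i)| ∧ |pev ζ (P i)| ≤ X ^ (-η)}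

/-- The exponent w_{n,j}(ζ). -/
noncomputable def wExpJ (n j : ℕ) (ζ : ℝ) : ℝ := sSup (wSetJ n j ζ)

/-- Set of exponents η such that for all sufficiently large X the polynomial system has
    at least j linearly independent solutions of degree at most n. -/
def whSetJ (n j : ℕ) (ζ : ℝ) : Set ℝ :=
  {η | ∃ X₀ : ℝ, ∀ X : ℝ, X₀ ≤ X → ∃ P : Fin j → Polynomial ℤ,
    LinearIndependent ℤ P ∧ ∀ i : Fin j,
      (P i).natDegree ≤ n ∧ polyH (P i) ≤ X ∧ 0 < |pev ζ (P i)| ∧ |pev ζ (P i)| ≤ X ^ (-η)}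

/-- The uniform exponent ŵ_{n,j}(ζ). -/
noncomputable def whExpJ (n j : ℕ) (ζ : ℝ) : ℝ := sSup (whSetJ n j ζ)

/-- Set of exponents η such that for arbitrarily large X the simultaneous approximation
    system has at least j linearly independent integer vector solutions. -/
def lamSetJ (n j : ℕ) (ζ : ℝ) : Set ℝ :=
  {η | ∀ X₀ : ℝ, ∃ X : ℝ, X₀ ≤ X ∧ ∃ v : Fin j → (Fin (n + 1) → ℤ),
    LinearIndependent ℤ v ∧ ∀ i : Fin j,
      ((|v i 0| : ℤ) : ℝ) ≤ X ∧
      ∀ t : Fin n, |ζ ^ ((t : ℕ) + 1) * ((v i 0 : ℤ) : ℝ) - ((v i t.succ : ℤ) : ℝ)| ≤ X ^ (-η)}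

/-- The exponent λ_{n,j}(ζ). -/
noncomputable def lamExpJ (n j : ℕ) (ζ : ℝ) : ℝ := sSup (lamSetJ n j ζ)

/-- Set of exponents η such that for all sufficiently large X the simultaneous approximation
    system has at least j linearly independent integer vector solutions. -/
def lamhSetJ (n j : ℕ) (ζ : ℝ) : Set ℝ :=
  {η | ∃ X₀ : ℝ, ∀ X : ℝ, X₀ ≤ X → ∃ v : Fin j → (Fin (n + 1) → ℤ),
    LinearIndependent ℤ v ∧ ∀ i : Fin j,
      ((|v i 0| : ℤ) : ℝ) ≤ X ∧
      ∀ t : Fin n, |ζ ^ ((t : ℕ) + 1) * ((v i 0 : ℤ) : ℝ) - ((v i t.succ : ℤ) : ℝ)| ≤ X ^ (-η)}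

/-- The uniform exponent λ̂_{n,j}(ζ). -/
noncomputable def lamhExpJ (n j : ℕ) (ζ : ℝ) : ℝ := sSup (lamhSetJ n j ζ)

/-- An extremal number: a real transcendental number with ŵ₂(ζ) = (3+√5)/2. -/
def IsExtremal (ζ : ℝ) : Prop :=
  Transcendental ℚ ζ ∧ whExp 2 ζ = (3 + Real.sqrt 5) / 2

open Real (log exp goldenRatio)

/-- The value at `ζ` of the quadratic form polynomial with coefficient vector `P`. -/
def quadEval (ζ : ℝ) (P : Fin 3 → ℤ) : ℝ := P 0 + P 1 * ζ + P 2 * ζ ^ 2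

/-- The resultant of two quadratic polynomials given by their coefficient vectors. -/
def quadRes (P Q : Fin 3 → ℤ) : ℤ :=
  (P 0 * Q 2 - P 2 * Q 0) ^ 2 - (P 0 * Q 1 - P 1 * Q 0) * (P 1 * Q 2 - P 2 * Q 1)

/-- For every large `X` there is a nonzero integer polynomial of degree at most `2` and height at
most `X` whose value at `ζ` is at most `X ^ (-ω)`. -/
def QuadUniform (ζ ω : ℝ) : Prop :=
  ∃ X₀ : ℝ, ∀ X ≥ X₀, ∃ P : Fin 3 → ℤ, P ≠ 0 ∧ ‖P‖ ≤ X ∧ |quadEval ζ P| ≤ X ^ (-ω)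

lemma abs_coeff_le_polyH (P : ℤ[X]) (i : ℕ) : |(P.coeff i : ℝ)| ≤ polyH P := by
  by_cases hi : i ∈ P.support
  · have h := Finset.le_sup (f := fun i => (P.coeff i).natAbs) hi
    have h' : (((P.coeff i).natAbs : ℕ) : ℝ) ≤ polyH P := by
      unfold polyH; exact_mod_cast h
    simpa [Nat.cast_natAbs] using h'
  · rw [Polynomial.notMem_support_iff.mp hi]
    simp [polyH]

lemma quadUniform_of_isExtremal {ζ : ℝ} (hζ : IsExtremal ζ) {ω : ℝ}
    (hω : ω < Real.goldenRatio + 1) : QuadUniform ζ ω := by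
  have hg : (3 + Real.sqrt 5) / 2 = Real.goldenRatio + 1 := by
    unfold Real.goldenRatio; ring
  have hne : (whSet 2 ζ).Nonempty := by
    rw [Set.nonempty_iff_ne_empty]
    intro h
    have h2 := hζ.2
    rw [whExp, h, Real.sSup_empty] at h2
    have := Real.sqrt_nonneg 5
    linarith
  have hlt : ω < sSup (whSet 2 ζ) := by
    rw [← whExp, hζ.2, hg]; exact hω
  obtain ⟨η, ⟨X₀, hX₀⟩, hη⟩ := exists_lt_of_lt_csSup hne hlt
  refine ⟨max X₀ 1, fun X hX => ?_⟩
  obtain ⟨P, hdeg, hH, hpos, hle⟩ := hX₀ X ((le_max_left _ _).trans hX)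
  have hX1 : 1 ≤ X := (le_max_right _ _).trans hX
  have hval : pev ζ P = quadEval ζ (fun i : Fin 3 => P.coeff i) := by
    rw [pev, Polynomial.aeval_eq_sum_range' (n := 3) (by omega)]
    simp [Finset.sum_range_succ, quadEval]
  refine ⟨fun i => P.coeff i, ?_, ?_, ?_⟩
  · intro h0
    rw [hval, h0] at hpos
    simp [quadEval] at hpos
  · rw [pi_norm_le_iff_of_nonneg (by linarith)]
    intro i
    rw [Int.norm_eq_abs]
    exact (abs_coeff_le_polyH P i).trans hH
  · rw [← hval]
    exact hle.trans (Real.rpow_le_rpow_of_exponent_le hX1 (by linarith))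

lemma exists_pos_le_abs_mul_sub {ζ : ℝ} (hζ : Irrational ζ) (D : ℕ) :
    ∃ c > 0, ∀ d : ℕ, 0 < d → d ≤ D → ∀ n : ℤ, c ≤ |(d : ℝ) * ζ - n| := by
  induction D with
  | zero => exact ⟨1, one_pos, fun d h1 h2 => by omega⟩
  | succ D ih =>
    obtain ⟨c, hc, h⟩ := ih
    have hirr : Irrational (((D + 1 : ℕ) : ℝ) * ζ) := hζ.natCast_mul (by omega)
    refine ⟨min c |((D + 1 : ℕ) : ℝ) * ζ - round (((D + 1 : ℕ) : ℝ) * ζ)|,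
      lt_min hc (abs_pos.mpr (sub_ne_zero.mpr (hirr.ne_int _))), fun d h1 h2 n => ?_⟩
    rcases Nat.lt_or_ge d (D + 1) with h3 | h3
    · exact (min_le_left _ _).trans (h d h1 (by omega) n)
    · obtain rfl : d = D + 1 := by omega
      exact (min_le_right _ _).trans (round_le _ _)

lemma abs_apply_le_norm {n : ℕ} (P : Fin n → ℤ) (i : Fin n) : |(P i : ℝ)| ≤ ‖P‖ := by
  have := norm_le_pi_norm P i
  rwa [Int.norm_eq_abs] at this

lemma eq_zero_of_isRoot_of_norm_lt_den {P : Fin 3 → ℤ} {r : ℚ} (hP : ‖P‖ < r.den)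
    (h : P 0 * (r.den : ℤ) ^ 2 + P 1 * r.num * r.den + P 2 * r.num ^ 2 = 0) : P = 0 := by
  have hlt : ∀ i, |P i| < (r.den : ℤ) := fun i => by
    have := (abs_apply_le_norm P i).trans_lt hP
    exact_mod_cast this
  have hcop : IsCoprime (r.den : ℤ) r.num :=
    (Int.isCoprime_iff_gcd_eq_one.mpr (by simpa [Int.gcd, Nat.Coprime] using r.reduced)).symm
  have hd : (r.den : ℤ) ≠ 0 := by exact_mod_cast r.den_ne_zero
  have h2 : P 2 = 0 := by
    have : (r.den : ℤ) ∣ P 2 * r.num ^ 2 := ⟨-(P 0 * r.den + P 1 * r.num), by linarith⟩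
    exact Int.eq_zero_of_abs_lt_dvd ((hcop.pow_right).dvd_of_dvd_mul_right this) (hlt 2)
  rw [h2] at h
  have h' : P 0 * (r.den : ℤ) + P 1 * r.num = 0 := by
    apply mul_left_cancel₀ hd; linarith
  have h1 : P 1 = 0 := by
    have : (r.den : ℤ) ∣ P 1 * r.num := ⟨-(P 0), by linarith⟩
    exact Int.eq_zero_of_abs_lt_dvd (hcop.dvd_of_dvd_mul_right this) (hlt 1)
  rw [h1] at h'
  have h0 : P 0 = 0 := by
    have : P 0 * (r.den : ℤ) = 0 := by linarith
    exact (mul_eq_zero.mp this).resolve_right hd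
  ext i; fin_cases i <;> simp [h0, h1, h2]

lemma exists_lower_bound_rat {ζ ω : ℝ} (hζ : Irrational ζ) (h : QuadUniform ζ ω) (hω : 2 < ω) :
    ∃ c > 0, ∀ r : ℚ, c / (r.den : ℝ) ^ 2 ≤ |(r.den : ℝ) * ζ - r.num| := by
  obtain ⟨X₀, hX₀⟩ := h
  have htend : Filter.Tendsto (fun x : ℝ => x ^ (-(ω - 2))) Filter.atTop (nhds 0) :=
    tendsto_rpow_neg_atTop (by linarith)
  obtain ⟨X₁, hX₁⟩ := Filter.eventually_atTop.mp
    (htend.eventually (gt_mem_nhds (show (0 : ℝ) < 1 / 8 by norm_num)))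
  obtain ⟨D, hD⟩ := exists_nat_ge (2 * max X₀ X₁ + 1)
  obtain ⟨c, hc, hcD⟩ := exists_pos_le_abs_mul_sub hζ D
  have hK : 0 < 2 * (1 + |ζ|) := by positivity
  refine ⟨min c (min 1 (1 / (2 * (1 + |ζ|)))), by positivity, fun r => ?_⟩
  have hd1 : (1 : ℝ) ≤ r.den := by exact_mod_cast r.den_pos
  have hsq : (1 : ℝ) ≤ (r.den : ℝ) ^ 2 := one_le_pow₀ hd1
  have hdd : (0 : ℝ) < r.den := by linarith
  set μ := min c (min 1 (1 / (2 * (1 + |ζ|)))) with hμ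
  have hμ0 : 0 < μ := by positivity
  have hμc : μ ≤ c := min_le_left _ _
  have hμ1 : μ ≤ 1 := (min_le_right _ _).trans (min_le_left _ _)
  have hμK : μ ≤ 1 / (2 * (1 + |ζ|)) := (min_le_right _ _).trans (min_le_right _ _)
  have hle : μ / (r.den : ℝ) ^ 2 ≤ μ := div_le_self hμ0.le hsq
  rcases le_or_gt r.den D with hdD | hdD
  · exact hle.trans (hμc.trans (hcD r.den r.den_pos hdD r.num))
  rcases le_or_gt 1 |(r.den : ℝ) * ζ - r.num| with hbig | hsmall
  · exact hle.trans (hμ1.trans hbig)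
  have hdDr : (D : ℝ) < r.den := by exact_mod_cast hdD
  set X : ℝ := (r.den : ℝ) / 2 with hX
  have hXX : max X₀ X₁ ≤ X := by rw [hX]; linarith
  obtain ⟨P, hP0, hPX, hPv⟩ := hX₀ X ((le_max_left _ _).trans hXX)
  have hXpos : 0 < X := by positivity
  have hdX : (r.den : ℝ) = 2 * X := by rw [hX]; ring
  have hres : P 0 * (r.den : ℤ) ^ 2 + P 1 * r.num * r.den + P 2 * r.num ^ 2 ≠ 0 := fun h0 =>
    hP0 (eq_zero_of_isRoot_of_norm_lt_den (by linarith) h0)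
  have hone : (1 : ℝ) ≤ |(P 0 * (r.den : ℝ) ^ 2 + P 1 * r.num * r.den + P 2 * r.num ^ 2)| := by
    exact_mod_cast Int.one_le_abs hres
  have hid : P 0 * (r.den : ℝ) ^ 2 + P 1 * r.num * r.den + P 2 * r.num ^ 2 =
      (r.den : ℝ) ^ 2 * quadEval ζ P - (r.den * ζ - r.num) *
        (P 1 * r.den + P 2 * (2 * (r.den * ζ) - (r.den * ζ - r.num))) := by
    unfold quadEval; ring
  have hterm : (r.den : ℝ) ^ 2 * |quadEval ζ P| ≤ 1 / 2 := by
    have h1 : X ^ (-ω) * X ^ 2 < 1 / 8 := by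
      rw [← Real.rpow_natCast X 2, ← Real.rpow_add hXpos]
      have := hX₁ X ((le_max_right _ _).trans hXX)
      rwa [show -ω + ((2 : ℕ) : ℝ) = -(ω - 2) by push_cast; ring]
    rw [hdX]
    nlinarith [sq_nonneg X]
  have hfac : |P 1 * (r.den : ℝ) + P 2 * (2 * (r.den * ζ) - (r.den * ζ - r.num))| ≤
      (r.den : ℝ) ^ 2 * (1 + |ζ|) := by
    have a1 := (abs_apply_le_norm P 1).trans hPX
    have a2 := (abs_apply_le_norm P 2).trans hPX
    have b : |2 * (r.den * ζ) - ((r.den : ℝ) * ζ - r.num)| ≤ 2 * r.den * |ζ| + r.den := by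
      calc _ ≤ |2 * ((r.den : ℝ) * ζ)| + |(r.den : ℝ) * ζ - r.num| := abs_sub _ _
        _ ≤ _ := by
          rw [abs_mul, abs_mul, abs_of_pos hdd, abs_two]; linarith
    calc _ ≤ |P 1 * (r.den : ℝ)| + |P 2 * (2 * (r.den * ζ) - ((r.den : ℝ) * ζ - r.num))| :=
          abs_add_le _ _
      _ ≤ X * r.den + X * (2 * r.den * |ζ| + r.den) := by
          rw [abs_mul, abs_mul, abs_of_pos hdd]
          gcongr
      _ = _ := by rw [hX]; ring
  rw [hid] at hone
  have h3 := hone.trans (abs_sub _ _)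
  rw [abs_mul, abs_mul, abs_of_pos (by positivity : (0 : ℝ) < (r.den : ℝ) ^ 2)] at h3
  have h4 : 1 / 2 ≤ |(r.den : ℝ) * ζ - r.num| * ((r.den : ℝ) ^ 2 * (1 + |ζ|)) := by
    have := mul_le_mul_of_nonneg_left hfac (abs_nonneg ((r.den : ℝ) * ζ - r.num))
    linarith
  rw [div_le_iff₀ (by positivity)]
  refine hμK.trans ?_
  rw [div_le_iff₀ hK]
  nlinarith

lemma exists_lower_bound_int {ζ ω : ℝ} (hζ : Irrational ζ) (h : QuadUniform ζ ω) (hω : 2 < ω) :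
    ∃ c > 0, ∀ q p : ℤ, q ≠ 0 → c / (q : ℝ) ^ 2 ≤ |(q : ℝ) * ζ - p| := by
  obtain ⟨c, hc, hr⟩ := exists_lower_bound_rat hζ h hω
  refine ⟨c, hc, fun q p hq => ?_⟩
  obtain ⟨k, h1, h2⟩ := Rat.num_den_mk hq (rfl : Rat.divInt p q = Rat.divInt p q)
  set r : ℚ := Rat.divInt p q
  have hk : k ≠ 0 := by rintro rfl; simp at h2; exact hq h2
  have hk1 : (1 : ℝ) ≤ |(k : ℝ)| := by exact_mod_cast Int.one_le_abs hk
  have hd : (0 : ℝ) < r.den := by exact_mod_cast r.den_pos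
  have e : (q : ℝ) * ζ - p = k * (r.den * ζ - r.num) := by
    rw [h1, h2]; push_cast; ring
  have e2 : (q : ℝ) ^ 2 = |(k : ℝ)| ^ 2 * (r.den : ℝ) ^ 2 := by
    rw [h2, sq_abs]; push_cast; ring
  rw [e, abs_mul, e2]
  calc c / (|(k : ℝ)| ^ 2 * (r.den : ℝ) ^ 2) ≤ c / (r.den : ℝ) ^ 2 := by
        apply div_le_div_of_nonneg_left hc.le (by positivity)
        exact le_mul_of_one_le_left (by positivity) (one_le_pow₀ hk1)
    _ ≤ 1 * |(r.den : ℝ) * ζ - r.num| := by rw [one_mul]; exact hr r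
    _ ≤ _ := by gcongr

lemma exists_lower_bound_reducible {ζ ω : ℝ} (hζ : Irrational ζ) (h : QuadUniform ζ ω)
    (hω : 2 < ω) : ∃ c > 0, ∀ P : Fin 3 → ℤ, P ≠ 0 →
      (P 2 = 0 ∨ ∃ r : ℚ, P 0 + P 1 * r + P 2 * r ^ 2 = 0) →
      c ≤ ‖P‖ ^ 2 * |quadEval ζ P| := by
  obtain ⟨c, hc, hlow⟩ := exists_lower_bound_int hζ h hω
  refine ⟨min 1 (min c (c ^ 2)), by positivity, fun P hP hred => ?_⟩
  have hn1 : 1 ≤ ‖P‖ := by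
    obtain ⟨i, hi⟩ := Function.ne_iff.mp hP
    refine le_trans ?_ (abs_apply_le_norm P i)
    exact_mod_cast Int.one_le_abs hi
  by_cases h2 : P 2 = 0
  · by_cases h1 : P 1 = 0
    · have h0 : P 0 ≠ 0 := fun h0 => hP (by ext i; fin_cases i <;> simp [h0, h1, h2])
      have : (1 : ℝ) ≤ |quadEval ζ P| := by
        simp only [quadEval, h1, h2]
        simpa using (by exact_mod_cast Int.one_le_abs h0 : (1 : ℝ) ≤ |(P 0 : ℝ)|)
      exact (min_le_left _ _).trans (by nlinarith [one_le_pow₀ hn1 (n := 2)])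
    · have := hlow (P 1) (-(P 0)) h1
      have hv : quadEval ζ P = (P 1 : ℝ) * ζ - ((-(P 0) : ℤ) : ℝ) := by
        simp only [quadEval, h2]; push_cast; ring
      rw [← hv, div_le_iff₀ (by positivity), mul_comm] at this
      refine (min_le_right _ _).trans ((min_le_left _ _).trans (this.trans ?_))
      refine mul_le_mul_of_nonneg_right ?_ (abs_nonneg _)
      rw [← sq_abs]
      exact pow_le_pow_left₀ (abs_nonneg _) (abs_apply_le_norm P 1) 2
  · obtain ⟨r, hr⟩ := hred.resolve_left h2
    have hd : (r.den : ℤ) ≠ 0 := by exact_mod_cast r.den_ne_zero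
    have hcop : IsCoprime (r.den : ℤ) r.num :=
      (Int.isCoprime_iff_gcd_eq_one.mpr (by simpa [Int.gcd, Nat.Coprime] using r.reduced)).symm
    have hroot : P 0 * (r.den : ℤ) ^ 2 + P 1 * r.num * r.den + P 2 * r.num ^ 2 = 0 := by
      have hrd : r * r.den = r.num := Rat.mul_den_eq_num r
      have : ((P 0 * (r.den : ℤ) ^ 2 + P 1 * r.num * r.den + P 2 * r.num ^ 2 : ℤ) : ℚ) = 0 := by
        push_cast
        rw [← hrd]
        linear_combination (r.den : ℚ) ^ 2 * hr
      exact_mod_cast this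
    obtain ⟨e, he⟩ : (r.den : ℤ) ∣ P 2 := by
      have : (r.den : ℤ) ∣ P 2 * r.num ^ 2 := ⟨-(P 0 * r.den + P 1 * r.num), by linarith⟩
      exact (hcop.pow_right).dvd_of_dvd_mul_right this
    have hroot' : P 0 * (r.den : ℤ) + P 1 * r.num + e * r.num ^ 2 = 0 := by
      apply mul_left_cancel₀ hd
      rw [he] at hroot; linarith
    obtain ⟨m, hm⟩ : (r.den : ℤ) ∣ e * r.num + P 1 := by
      have : (r.den : ℤ) ∣ (e * r.num + P 1) * r.num := ⟨-(P 0), by linarith⟩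
      exact hcop.dvd_of_dvd_mul_right this
    have h0 : P 0 = -(m * r.num) := by
      apply mul_left_cancel₀ hd
      have : (e * r.num + P 1) * r.num = r.den * m * r.num := by rw [hm]
      linarith
    have he0 : e ≠ 0 := by rintro rfl; simp at he; exact h2 he
    have hfac : quadEval ζ P = ((r.den : ℤ) * ζ - r.num) * ((e : ℝ) * ζ - ((-m : ℤ) : ℝ)) := by
      have h1 : P 1 = r.den * m - e * r.num := by linarith
      simp only [quadEval, h0, h1, he]; push_cast; ring
    have l1 := hlow r.den r.num hd
    have l2 := hlow e (-m) he0
    have hd' : ((r.den : ℤ) : ℝ) ≠ 0 := by exact_mod_cast hd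
    have he' : (e : ℝ) ≠ 0 := by exact_mod_cast he0
    refine (min_le_right _ _).trans ((min_le_right _ _).trans ?_)
    rw [hfac, abs_mul]
    have hP2 : (P 2 : ℝ) ^ 2 = ((r.den : ℤ) : ℝ) ^ 2 * (e : ℝ) ^ 2 := by rw [he]; push_cast; ring
    have hn : ((r.den : ℤ) : ℝ) ^ 2 * (e : ℝ) ^ 2 ≤ ‖P‖ ^ 2 := by
      rw [← hP2, ← sq_abs]
      exact pow_le_pow_left₀ (abs_nonneg _) (abs_apply_le_norm P 2) 2
    calc c ^ 2 = (((r.den : ℤ) : ℝ) ^ 2 * (e : ℝ) ^ 2) *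
          (c / ((r.den : ℤ) : ℝ) ^ 2 * (c / (e : ℝ) ^ 2)) := by field_simp
      _ ≤ _ := by gcongr

/-- The cross product of two integer vectors in dimension `3`. -/
def quadWedge (P Q : Fin 3 → ℤ) : Fin 3 → ℤ :=
  ![P 1 * Q 2 - P 2 * Q 1, P 2 * Q 0 - P 0 * Q 2, P 0 * Q 1 - P 1 * Q 0]

/-- The determinant of three integer vectors in dimension `3`. -/
def quadDet (P Q R : Fin 3 → ℤ) : ℤ :=
  P 0 * quadWedge Q R 0 + P 1 * quadWedge Q R 1 + P 2 * quadWedge Q R 2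

/-- A sequence of minimal quadratic polynomials for `ζ`. -/
structure IsMinSeq (ζ : ℝ) (P : ℕ → Fin 3 → ℤ) : Prop where
  ne_zero : ∀ i, P i ≠ 0
  norm_lt : ∀ i, ‖P i‖ < ‖P (i + 1)‖
  eval_lt : ∀ i, |quadEval ζ (P (i + 1))| < |quadEval ζ (P i)|
  le_eval : ∀ i, ∀ Q : Fin 3 → ℤ, Q ≠ 0 → ‖Q‖ < ‖P (i + 1)‖ →
    |quadEval ζ (P i)| ≤ |quadEval ζ Q|

lemma exists_norm_eq_abs_apply (P : Fin 3 → ℤ) : ∃ i, ‖P‖ = |(P i : ℝ)| := by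
  obtain ⟨i, hi⟩ := Finite.exists_max fun i => ‖P i‖
  refine ⟨i, le_antisymm ?_ (abs_apply_le_norm P i)⟩
  rw [pi_norm_le_iff_of_nonneg (abs_nonneg _)]
  intro j
  rw [← Int.norm_eq_abs]
  exact hi j

lemma exists_norm_eq_natCast (P : Fin 3 → ℤ) : ∃ n : ℕ, ‖P‖ = n := by
  obtain ⟨i, hi⟩ := exists_norm_eq_abs_apply P
  exact ⟨(P i).natAbs, by rw [hi, Nat.cast_natAbs]; push_cast; rfl⟩

lemma one_le_norm_of_ne_zero {n : ℕ} {P : Fin n → ℤ} (hP : P ≠ 0) : 1 ≤ ‖P‖ := by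
  obtain ⟨i, hi⟩ := Function.ne_iff.mp hP
  refine le_trans ?_ (abs_apply_le_norm P i)
  exact_mod_cast Int.one_le_abs hi

lemma exists_min_eval (ζ : ℝ) (N : ℝ) (h : ∃ Q : Fin 3 → ℤ, Q ≠ 0 ∧ ‖Q‖ ≤ N) :
    ∃ P : Fin 3 → ℤ, (P ≠ 0 ∧ ‖P‖ ≤ N) ∧
      ∀ Q : Fin 3 → ℤ, Q ≠ 0 → ‖Q‖ ≤ N → |quadEval ζ P| ≤ |quadEval ζ Q| := by
  have hfin : {Q : Fin 3 → ℤ | Q ≠ 0 ∧ ‖Q‖ ≤ N}.Finite := by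
    refine Set.Finite.subset (isCompact_closedBall (0 : Fin 3 → ℤ) N).finite_of_discrete ?_
    rintro Q ⟨-, hQ⟩
    simpa using hQ
  obtain ⟨P, hP, hmin⟩ := Set.exists_min_image _ (fun Q => |quadEval ζ Q|) hfin h
  exact ⟨P, hP, fun Q h1 h2 => hmin Q ⟨h1, h2⟩⟩

lemma exists_isMinSeq {ζ ω : ℝ} (hind : ∀ P : Fin 3 → ℤ, quadEval ζ P = 0 → P = 0)
    (h : QuadUniform ζ ω) (hω : 0 < ω) : ∃ P, IsMinSeq ζ P := by
  let M : Type := {P : Fin 3 → ℤ // P ≠ 0 ∧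
    ∀ Q : Fin 3 → ℤ, Q ≠ 0 → ‖Q‖ ≤ ‖P‖ → |quadEval ζ P| ≤ |quadEval ζ Q|}
  have hsmall : ∀ P : Fin 3 → ℤ, P ≠ 0 →
      ∃ N : ℕ, ∃ Q : Fin 3 → ℤ, Q ≠ 0 ∧ ‖Q‖ ≤ N ∧ |quadEval ζ Q| < |quadEval ζ P| := by
    intro P hP
    obtain ⟨X₀, hX₀⟩ := h
    have hpos : 0 < |quadEval ζ P| := abs_pos.mpr fun h0 => hP (hind P h0)
    obtain ⟨X₁, hX₁⟩ := Filter.eventually_atTop.mp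
      ((tendsto_rpow_neg_atTop hω).eventually (gt_mem_nhds hpos))
    obtain ⟨Q, h1, h2, h3⟩ := hX₀ (max X₀ X₁) (le_max_left _ _)
    obtain ⟨N, hN⟩ := exists_nat_ge (max X₀ X₁)
    exact ⟨N, Q, h1, h2.trans hN, h3.trans_lt (hX₁ _ (le_max_right _ _))⟩
  have hnext : ∀ P : M, ∃ P' : M, ‖P.1‖ < ‖P'.1‖ ∧ |quadEval ζ P'.1| < |quadEval ζ P.1| ∧
      ∀ Q : Fin 3 → ℤ, Q ≠ 0 → ‖Q‖ < ‖P'.1‖ → |quadEval ζ P.1| ≤ |quadEval ζ Q| := by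
    classical
    rintro ⟨P, hP0, hPmin⟩
    have hex := hsmall P hP0
    obtain ⟨Q, hQ0, hQN, hQP⟩ := Nat.find_spec hex
    obtain ⟨P', ⟨hP'0, hP'N⟩, hP'min⟩ := exists_min_eval ζ (Nat.find hex : ℕ) ⟨Q, hQ0, hQN⟩
    have hlt : |quadEval ζ P'| < |quadEval ζ P| := (hP'min Q hQ0 hQN).trans_lt hQP
    refine ⟨⟨P', hP'0, fun R h1 h2 => hP'min R h1 (h2.trans hP'N)⟩, ?_, hlt, ?_⟩
    · by_contra! hle
      exact absurd (hPmin P' hP'0 hle) (not_le.mpr hlt)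
    · intro R hR0 hR
      by_contra! hRP
      obtain ⟨n, hn⟩ := exists_norm_eq_natCast R
      have hnN : n < Nat.find hex := by
        have := hR.trans_le hP'N
        rw [hn] at this
        exact_mod_cast this
      exact Nat.find_min hex hnN ⟨R, hR0, hn.le, hRP⟩
  choose nxt h1 h2 h3 using hnext
  have h10 : (fun _ => 1 : Fin 3 → ℤ) ≠ 0 := fun h => by simpa using congrFun h 0
  obtain ⟨P₀, ⟨hP₀, hP₀N⟩, hP₀min⟩ := exists_min_eval ζ _ ⟨_, h10, le_rfl⟩
  let P₀' : M := ⟨P₀, hP₀, fun Q h1 h2 => hP₀min Q h1 (h2.trans hP₀N)⟩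
  have hsucc : ∀ i, nxt^[i + 1] P₀' = nxt (nxt^[i] P₀') := fun i =>
    Function.iterate_succ_apply' nxt i P₀'
  refine ⟨fun i => (nxt^[i] P₀').1, fun i => (nxt^[i] P₀').2.1, fun i => ?_, fun i => ?_,
    fun i => ?_⟩
  · simp only [hsucc]; exact h1 _
  · simp only [hsucc]; exact h2 _
  · simp only [hsucc]; exact h3 _

lemma quadRes_eq (P Q : Fin 3 → ℤ) :
    quadRes P Q = quadWedge P Q 1 ^ 2 - quadWedge P Q 2 * quadWedge P Q 0 := by
  simp [quadRes, quadWedge]; ring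

lemma reducible_of_quadRes_eq_zero {P Q : Fin 3 → ℤ} (hw : quadWedge P Q ≠ 0)
    (h : quadRes P Q = 0) : P 2 = 0 ∨ ∃ r : ℚ, P 0 + P 1 * r + P 2 * r ^ 2 = 0 := by
  rw [quadRes_eq] at h
  have horth : P 0 * quadWedge P Q 0 + P 1 * quadWedge P Q 1 + P 2 * quadWedge P Q 2 = 0 := by
    simp [quadWedge]; ring
  by_cases h0 : quadWedge P Q 0 = 0
  · left
    have h1 : quadWedge P Q 1 = 0 := by
      rw [h0, mul_zero, sub_zero] at h
      exact pow_eq_zero_iff two_ne_zero |>.mp h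
    have h2 : quadWedge P Q 2 ≠ 0 := fun h2 => hw (by ext i; fin_cases i <;> simp [h0, h1, h2])
    rw [h0, h1] at horth
    simpa [h2] using horth
  · right
    have h0' : (quadWedge P Q 0 : ℚ) ≠ 0 := by exact_mod_cast h0
    refine ⟨quadWedge P Q 1 / quadWedge P Q 0, ?_⟩
    have e1 : (quadWedge P Q 1 : ℚ) ^ 2 = quadWedge P Q 2 * quadWedge P Q 0 := by
      have : quadWedge P Q 1 ^ 2 = quadWedge P Q 2 * quadWedge P Q 0 := by linarith
      exact_mod_cast this
    have e2 : (P 0 : ℚ) * quadWedge P Q 0 + P 1 * quadWedge P Q 1 + P 2 * quadWedge P Q 2 = 0 := by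
      exact_mod_cast horth
    rw [div_pow, e1]
    field_simp
    linear_combination e2

lemma quadWedge_ne_zero {ζ : ℝ} {P Q : Fin 3 → ℤ} (hn : ‖P‖ < ‖Q‖)
    (hv : |quadEval ζ Q| < |quadEval ζ P|) : quadWedge P Q ≠ 0 := by
  intro hw
  obtain ⟨k, hk⟩ := exists_norm_eq_abs_apply Q
  have e0 : P 1 * Q 2 - P 2 * Q 1 = 0 := by simpa [quadWedge] using congrFun hw 0
  have e1 : P 2 * Q 0 - P 0 * Q 2 = 0 := by simpa [quadWedge] using congrFun hw 1
  have e2 : P 0 * Q 1 - P 1 * Q 0 = 0 := by simpa [quadWedge] using congrFun hw 2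
  have e0' : (P 1 : ℝ) * Q 2 - P 2 * Q 1 = 0 := by exact_mod_cast e0
  have e1' : (P 2 : ℝ) * Q 0 - P 0 * Q 2 = 0 := by exact_mod_cast e1
  have e2' : (P 0 : ℝ) * Q 1 - P 1 * Q 0 = 0 := by exact_mod_cast e2
  have key : (Q k : ℝ) * quadEval ζ P = P k * quadEval ζ Q := by
    fin_cases k <;> simp only [quadEval, Fin.zero_eta, Fin.mk_one, Fin.reduceFinMk]
    · linear_combination -ζ * e2' + ζ ^ 2 * e1'
    · linear_combination e2' - ζ ^ 2 * e0'
    · linear_combination -e1' + ζ * e0'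
  have h1 : ‖Q‖ * |quadEval ζ P| = |(P k : ℝ)| * |quadEval ζ Q| := by
    rw [hk, ← abs_mul, key, abs_mul]
  have h2 := abs_apply_le_norm P k
  have h3 : 0 ≤ |quadEval ζ Q| := abs_nonneg _
  have h4 : 0 ≤ |(P k : ℝ)| := abs_nonneg _
  nlinarith

lemma abs_quadEval_le (ζ : ℝ) (P : Fin 3 → ℤ) :
    |quadEval ζ P| ≤ (1 + |ζ| + ζ ^ 2) * ‖P‖ := by
  have h0 := abs_apply_le_norm P 0
  have h1 := abs_apply_le_norm P 1
  have h2 := abs_apply_le_norm P 2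
  calc |quadEval ζ P| ≤ |(P 0 : ℝ)| + |P 1 * ζ| + |P 2 * ζ ^ 2| := abs_add_three _ _ _
    _ = |(P 0 : ℝ)| + |(P 1 : ℝ)| * |ζ| + |(P 2 : ℝ)| * ζ ^ 2 := by
      rw [abs_mul, abs_mul, abs_of_nonneg (sq_nonneg ζ)]
    _ ≤ ‖P‖ + ‖P‖ * |ζ| + ‖P‖ * ζ ^ 2 := by gcongr
    _ = _ := by ring

lemma quadWedge_zero (P Q : Fin 3 → ℤ) : quadWedge P Q 0 = P 1 * Q 2 - P 2 * Q 1 := rfl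
lemma quadWedge_one (P Q : Fin 3 → ℤ) : quadWedge P Q 1 = P 2 * Q 0 - P 0 * Q 2 := rfl
lemma quadWedge_two (P Q : Fin 3 → ℤ) : quadWedge P Q 2 = P 0 * Q 1 - P 1 * Q 0 := rfl

lemma abs_mul_sub_mul_le {a b c d A B C D : ℝ} (ha : |a| ≤ A) (hb : |b| ≤ B) (hc : |c| ≤ C)
    (hd : |d| ≤ D) : |a * b - c * d| ≤ A * B + C * D := by
  have := abs_nonneg a; have := abs_nonneg b; have := abs_nonneg c; have := abs_nonneg d
  calc |a * b - c * d| ≤ |a * b| + |c * d| := abs_sub _ _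
    _ ≤ A * B + C * D := by rw [abs_mul, abs_mul]; gcongr <;> linarith

lemma abs_quadWedge_le (P Q : Fin 3 → ℤ) (i : Fin 3) :
    |(quadWedge P Q i : ℝ)| ≤ 2 * (‖P‖ * ‖Q‖) := by
  have hP := abs_apply_le_norm P
  have hQ := abs_apply_le_norm Q
  fin_cases i
  all_goals
    simp only [Fin.zero_eta, Fin.mk_one, Fin.reduceFinMk, quadWedge_zero, quadWedge_one,
      quadWedge_two]
    push_cast
    refine (abs_mul_sub_mul_le (hP _) (hQ _) (hP _) (hQ _)).trans (le_of_eq (by ring))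

lemma abs_quadWedge_sub_le {ζ : ℝ} {P Q : Fin 3 → ℤ} (hn : ‖P‖ ≤ ‖Q‖)
    (hv : |quadEval ζ Q| ≤ |quadEval ζ P|) :
    |ζ * quadWedge P Q 0 - quadWedge P Q 1| ≤ 2 * (|quadEval ζ P| * ‖Q‖) ∧
      |ζ ^ 2 * quadWedge P Q 0 - quadWedge P Q 2| ≤ 2 * (|quadEval ζ P| * ‖Q‖) := by
  have hP := abs_apply_le_norm P
  have hQ := abs_apply_le_norm Q
  have key : |quadEval ζ P| * ‖Q‖ + |quadEval ζ Q| * ‖P‖ ≤ 2 * (|quadEval ζ P| * ‖Q‖) := by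
    have := mul_le_mul hv hn (norm_nonneg _) (abs_nonneg _)
    linarith
  constructor
  · have e : ζ * quadWedge P Q 0 - quadWedge P Q 1 =
        quadEval ζ P * Q 2 - quadEval ζ Q * P 2 := by
      rw [quadWedge_zero, quadWedge_one]; simp only [quadEval]; push_cast; ring
    rw [e]
    exact (abs_mul_sub_mul_le le_rfl (hQ 2) le_rfl (hP 2)).trans key
  · have e : ζ ^ 2 * quadWedge P Q 0 - quadWedge P Q 2 =
        -(quadEval ζ P * Q 1 - quadEval ζ Q * P 1) := by
      rw [quadWedge_zero, quadWedge_two]; simp only [quadEval]; push_cast; ring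
    rw [e, abs_neg]
    exact (abs_mul_sub_mul_le le_rfl (hQ 1) le_rfl (hP 1)).trans key

lemma one_le_of_quadRes_ne_zero {ζ : ℝ} {P Q : Fin 3 → ℤ} (hn : ‖P‖ ≤ ‖Q‖)
    (hv : |quadEval ζ Q| ≤ |quadEval ζ P|) (h : quadRes P Q ≠ 0) :
    1 ≤ 16 * (1 + |ζ| + ζ ^ 2) * (|quadEval ζ P| * ‖P‖ * ‖Q‖ ^ 2) := by
  obtain ⟨hu, hw⟩ := abs_quadWedge_sub_le hn hv
  have h0 := abs_quadWedge_le P Q 0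
  have hone : (1 : ℝ) ≤ |(quadRes P Q : ℝ)| := by exact_mod_cast Int.one_le_abs h
  set u := ζ * quadWedge P Q 0 - quadWedge P Q 1 with hudef
  set w := ζ ^ 2 * quadWedge P Q 0 - quadWedge P Q 2 with hwdef
  set x : ℝ := ((quadWedge P Q 0 : ℤ) : ℝ)
  set p := |quadEval ζ P| with hp
  have e : (quadRes P Q : ℝ) = u ^ 2 + x * (w - 2 * ζ * u) := by
    rw [quadRes_eq, hudef, hwdef]; push_cast; ring
  have hp0 : 0 ≤ p := abs_nonneg _
  have hP0 : 0 ≤ ‖P‖ := norm_nonneg _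
  have hQ0 : 0 ≤ ‖Q‖ := norm_nonneg _
  have hζ0 : 0 ≤ |ζ| := abs_nonneg _
  have hpM : p ≤ (1 + |ζ| + ζ ^ 2) * ‖P‖ := abs_quadEval_le ζ P
  have h1 : |u ^ 2| ≤ 4 * (1 + |ζ| + ζ ^ 2) * (p * ‖P‖ * ‖Q‖ ^ 2) := by
    rw [abs_pow]
    calc |u| ^ 2 ≤ (2 * (p * ‖Q‖)) ^ 2 := pow_le_pow_left₀ (abs_nonneg _) hu 2
      _ = 4 * (p * ‖Q‖ ^ 2) * p := by ring
      _ ≤ 4 * (p * ‖Q‖ ^ 2) * ((1 + |ζ| + ζ ^ 2) * ‖P‖) := by gcongr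
      _ = _ := by ring
  have h2 : |x * (w - 2 * ζ * u)| ≤ 2 * (‖P‖ * ‖Q‖) * ((1 + 2 * |ζ|) * (2 * (p * ‖Q‖))) := by
    rw [abs_mul]
    gcongr
    calc |w - 2 * ζ * u| ≤ |w| + |2 * ζ * u| := abs_sub _ _
      _ = |w| + 2 * |ζ| * |u| := by rw [abs_mul, abs_mul, abs_two]
      _ ≤ 2 * (p * ‖Q‖) + 2 * |ζ| * (2 * (p * ‖Q‖)) := by gcongr
      _ = _ := by ring
  rw [e] at hone
  have h3 := hone.trans ((abs_add_le _ _).trans (add_le_add h1 h2))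
  have h4 : 0 ≤ p * ‖P‖ * ‖Q‖ ^ 2 := by positivity
  nlinarith [mul_nonneg hζ0 h4, mul_nonneg (sq_nonneg ζ) h4]

lemma one_le_of_quadDet_ne_zero {ζ : ℝ} {P Q R : Fin 3 → ℤ} (hPQ : ‖P‖ ≤ ‖Q‖) (hQR : ‖Q‖ ≤ ‖R‖)
    (hvPQ : |quadEval ζ Q| ≤ |quadEval ζ P|) (hvQR : |quadEval ζ R| ≤ |quadEval ζ Q|)
    (h : quadDet P Q R ≠ 0) : 1 ≤ 6 * (|quadEval ζ P| * ‖Q‖ * ‖R‖) := by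
  have hone : (1 : ℝ) ≤ |(quadDet P Q R : ℝ)| := by exact_mod_cast Int.one_le_abs h
  obtain ⟨hu, hw⟩ := abs_quadWedge_sub_le hQR hvQR
  have e : (quadDet P Q R : ℝ) = quadEval ζ P * quadWedge Q R 0 -
      P 1 * (ζ * quadWedge Q R 0 - quadWedge Q R 1) -
      P 2 * (ζ ^ 2 * quadWedge Q R 0 - quadWedge Q R 2) := by
    simp only [quadDet, quadEval]; push_cast; ring
  have hb : 2 * (|quadEval ζ Q| * ‖R‖) ≤ 2 * (|quadEval ζ P| * ‖R‖) := by gcongr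
  rw [e] at hone
  have h1 : |quadEval ζ P * quadWedge Q R 0| ≤ |quadEval ζ P| * (2 * (‖Q‖ * ‖R‖)) := by
    rw [abs_mul]; gcongr; exact abs_quadWedge_le Q R 0
  have h2 : |P 1 * (ζ * quadWedge Q R 0 - quadWedge Q R 1)| ≤
      ‖Q‖ * (2 * (|quadEval ζ P| * ‖R‖)) := by
    rw [abs_mul]; gcongr
    · exact (abs_apply_le_norm P 1).trans hPQ
    · exact hu.trans hb
  have h3 : |P 2 * (ζ ^ 2 * quadWedge Q R 0 - quadWedge Q R 2)| ≤
      ‖Q‖ * (2 * (|quadEval ζ P| * ‖R‖)) := by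
    rw [abs_mul]; gcongr
    · exact (abs_apply_le_norm P 2).trans hPQ
    · exact hw.trans hb
  have h4 := abs_sub (quadEval ζ P * quadWedge Q R 0 -
      P 1 * (ζ * quadWedge Q R 0 - quadWedge Q R 1))
      (P 2 * (ζ ^ 2 * quadWedge Q R 0 - quadWedge Q R 2))
  have h5 := abs_sub (quadEval ζ P * quadWedge Q R 0)
      (P 1 * (ζ * quadWedge Q R 0 - quadWedge Q R 1))
  nlinarith

lemma exists_eq_add_mul_of_quadDet_eq_zero {ζ : ℝ} {P : ℕ → Fin 3 → ℤ} (hP : IsMinSeq ζ P) {k : ℕ}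
    (h : quadDet (P k) (P (k + 1)) (P (k + 2)) = 0) :
    ∃ a b : ℤ, ∀ c, P (k + 2) c = a * P (k + 1) c + b * P k c := by
  have hW := quadWedge_ne_zero (hP.norm_lt k) (hP.eval_lt k)
  have hn := hP.norm_lt k
  have hv := hP.eval_lt k
  have hle := hP.le_eval k
  set A := P k
  set B := P (k + 1)
  set R := P (k + 2)
  obtain ⟨m, hm⟩ := Function.ne_iff.mp hW
  have hm' : (quadWedge A B m : ℝ) ≠ 0 := by exact_mod_cast hm
  have hcr : ∀ c, quadWedge A B m * R c = quadWedge A R m * B c + quadWedge R B m * A c := by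
    simp only [quadDet, quadWedge_zero, quadWedge_one, quadWedge_two] at h
    intro c
    fin_cases m <;> fin_cases c <;>
      simp only [Fin.zero_eta, Fin.mk_one, Fin.reduceFinMk, quadWedge_zero, quadWedge_one,
        quadWedge_two] <;> first | ring1 | linear_combination h
  set s : ℝ := quadWedge A R m / quadWedge A B m
  set t : ℝ := quadWedge R B m / quadWedge A B m
  have hst : ∀ c, (R c : ℝ) = s * B c + t * A c := by
    intro c
    have : (quadWedge A B m : ℝ) * R c = quadWedge A R m * B c + quadWedge R B m * A c := by
      exact_mod_cast hcr c
    simp only [s, t]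
    field_simp
    linear_combination this
  have hs : |s - round s| ≤ 1 / 2 := abs_sub_round s
  have ht : |t - round t| ≤ 1 / 2 := abs_sub_round t
  let D : Fin 3 → ℤ := fun c => R c - round s * B c - round t * A c
  have hD : ∀ c, (D c : ℝ) = (s - round s) * B c + (t - round t) * A c := by
    intro c
    simp only [D]; push_cast
    rw [hst c]; ring
  have hval : quadEval ζ D = (s - round s) * quadEval ζ B + (t - round t) * quadEval ζ A := by
    simp only [quadEval, hD]; ring
  have hDn : ‖D‖ ≤ 1 / 2 * ‖B‖ + 1 / 2 * ‖A‖ := by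
    rw [pi_norm_le_iff_of_nonneg (by positivity)]
    intro c
    rw [Int.norm_eq_abs, hD]
    refine (abs_add_le _ _).trans ?_
    rw [abs_mul, abs_mul]
    gcongr
    · exact abs_apply_le_norm B c
    · exact abs_apply_le_norm A c
  have hDv : |quadEval ζ D| ≤ 1 / 2 * |quadEval ζ B| + 1 / 2 * |quadEval ζ A| := by
    rw [hval]
    refine (abs_add_le _ _).trans ?_
    rw [abs_mul, abs_mul]
    gcongr
  have hD0 : D = 0 := by
    by_contra hD0
    have := hle D hD0 (by linarith)
    linarith
  refine ⟨round s, round t, fun c => ?_⟩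
  have : D c = 0 := congrFun hD0 c
  simp only [D] at this
  linarith

lemma exists_quadWedge_eq_mul_of_quadDet_eq_zero {ζ : ℝ} {P : ℕ → Fin 3 → ℤ} (hP : IsMinSeq ζ P)
    {k : ℕ} (h : quadDet (P k) (P (k + 1)) (P (k + 2)) = 0) :
    ∃ t : ℤ, t ≠ 0 ∧ ∀ c, quadWedge (P (k + 1)) (P (k + 2)) c = t * quadWedge (P k) (P (k + 1)) c := by
  obtain ⟨a, b, hab⟩ := exists_eq_add_mul_of_quadDet_eq_zero hP h
  have e : ∀ c, quadWedge (P (k + 1)) (P (k + 2)) c = -b * quadWedge (P k) (P (k + 1)) c := by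
    intro c
    fin_cases c <;>
      simp only [Fin.zero_eta, Fin.mk_one, Fin.reduceFinMk, quadWedge_zero, quadWedge_one,
        quadWedge_two, hab] <;> ring
  refine ⟨-b, fun hb => ?_, e⟩
  refine quadWedge_ne_zero (hP.norm_lt (k + 1)) (hP.eval_lt (k + 1)) ?_
  ext c
  rw [e, hb, zero_mul, Pi.zero_apply]

lemma exists_quadWedge_eq_mul {ζ : ℝ} {P : ℕ → Fin 3 → ℤ} (hP : IsMinSeq ζ P) (j d : ℕ)
    (h : ∀ k, j ≤ k → k < j + d → quadDet (P k) (P (k + 1)) (P (k + 2)) = 0) :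
    ∃ t : ℤ, t ≠ 0 ∧
      ∀ c, quadWedge (P (j + d)) (P (j + d + 1)) c = t * quadWedge (P j) (P (j + 1)) c := by
  induction d with
  | zero => exact ⟨1, one_ne_zero, fun c => by simp⟩
  | succ d ih =>
    obtain ⟨t, ht, e⟩ := ih fun k h1 h2 => h k h1 (by omega)
    obtain ⟨t', ht', e'⟩ :=
      exists_quadWedge_eq_mul_of_quadDet_eq_zero hP (h (j + d) (by omega) (by omega))
    refine ⟨t' * t, mul_ne_zero ht' ht, fun c => ?_⟩
    rw [mul_assoc, ← e c, ← e' c]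
    rfl

lemma abs_mul_le_of_int_mul {ζ : ℝ} {P : ℕ → Fin 3 → ℤ} (hP : IsMinSeq ζ P) (j d : ℕ)
    (h : ∀ k, j ≤ k → k < j + d → quadDet (P k) (P (k + 1)) (P (k + 2)) = 0) :
    |ζ * quadWedge (P j) (P (j + 1)) 0 - quadWedge (P j) (P (j + 1)) 1| ≤
        2 * (|quadEval ζ (P (j + d))| * ‖P (j + d + 1)‖) ∧
      |ζ ^ 2 * quadWedge (P j) (P (j + 1)) 0 - quadWedge (P j) (P (j + 1)) 2| ≤
        2 * (|quadEval ζ (P (j + d))| * ‖P (j + d + 1)‖) := by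
  obtain ⟨t, ht, e⟩ := exists_quadWedge_eq_mul hP j d h
  obtain ⟨h1, h2⟩ := abs_quadWedge_sub_le (hP.norm_lt (j + d)).le (hP.eval_lt (j + d)).le
  have ht1 : (1 : ℝ) ≤ |(t : ℝ)| := by exact_mod_cast Int.one_le_abs ht
  rw [e 0, e 1] at h1
  rw [e 0, e 2] at h2
  push_cast at h1 h2
  constructor
  · refine le_trans ?_ h1
    rw [show ∀ a b : ℝ, ζ * (t * a) - t * b = t * (ζ * a - b) by intros; ring, abs_mul]
    exact le_mul_of_one_le_left (abs_nonneg _) ht1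
  · refine le_trans ?_ h2
    rw [show ∀ a b : ℝ, ζ ^ 2 * (t * a) - t * b = t * (ζ ^ 2 * a - b) by intros; ring, abs_mul]
    exact le_mul_of_one_le_left (abs_nonneg _) ht1

lemma abs_mul_norm_le {ζ E : ℝ} {P Q : Fin 3 → ℤ} (hv : |quadEval ζ Q| ≤ |quadEval ζ P|)
    (hn : 4 * (1 + |ζ| + ζ ^ 2) * ‖P‖ ≤ ‖Q‖)
    (h1 : |ζ * quadWedge P Q 0 - quadWedge P Q 1| ≤ E)
    (h2 : |ζ ^ 2 * quadWedge P Q 0 - quadWedge P Q 2| ≤ E) :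
    |quadEval ζ P| * ‖Q‖ ≤ 2 * (1 + |ζ| + ζ ^ 2) * E := by
  have e1 : ζ * quadWedge P Q 0 - quadWedge P Q 1 = quadEval ζ P * Q 2 - quadEval ζ Q * P 2 := by
    rw [quadWedge_zero, quadWedge_one]; simp only [quadEval]; push_cast; ring
  have e2 : ζ ^ 2 * quadWedge P Q 0 - quadWedge P Q 2 =
      -(quadEval ζ P * Q 1 - quadEval ζ Q * P 1) := by
    rw [quadWedge_zero, quadWedge_two]; simp only [quadEval]; push_cast; ring
  rw [e1] at h1
  rw [e2, abs_neg] at h2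
  have hpM := abs_quadEval_le ζ P
  have key : ∀ c, |quadEval ζ P * Q c - quadEval ζ Q * P c| ≤ E →
      |quadEval ζ P| * |(Q c : ℝ)| ≤ E + |quadEval ζ P| * ‖P‖ := by
    intro c hc
    have h3 : |quadEval ζ Q * P c| ≤ |quadEval ζ P| * ‖P‖ := by
      rw [abs_mul]; gcongr; exact abs_apply_le_norm P c
    have h4 := abs_sub_abs_le_abs_sub (quadEval ζ P * Q c) (quadEval ζ Q * P c)
    rw [abs_mul] at h4
    linarith
  have k1 := key 1 h2
  have k2 := key 2 h1
  have hE : 0 ≤ E := (abs_nonneg _).trans h1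
  set p := |quadEval ζ P| with hp
  have hp0 : 0 ≤ p := abs_nonneg _
  have hζ0 : 0 ≤ |ζ| := abs_nonneg _
  have hP0 : 0 ≤ ‖P‖ := norm_nonneg _
  set F := E + p * ‖P‖ with hF
  have hF0 : 0 ≤ F := by positivity
  have k0 : p * |(Q 0 : ℝ)| ≤ p * p + (|ζ| + ζ ^ 2) * F := by
    have e0 : (Q 0 : ℝ) = quadEval ζ Q - Q 1 * ζ - Q 2 * ζ ^ 2 := by simp only [quadEval]; ring
    have : |(Q 0 : ℝ)| ≤ p + |(Q 1 : ℝ)| * |ζ| + |(Q 2 : ℝ)| * ζ ^ 2 := by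
      rw [e0]
      refine (abs_sub _ _).trans (add_le_add ((abs_sub _ _).trans (add_le_add hv ?_)) ?_)
      · rw [abs_mul]
      · rw [abs_mul, abs_of_nonneg (sq_nonneg ζ)]
    calc p * |(Q 0 : ℝ)| ≤ p * (p + |(Q 1 : ℝ)| * |ζ| + |(Q 2 : ℝ)| * ζ ^ 2) := by gcongr
      _ = p * p + |ζ| * (p * |(Q 1 : ℝ)|) + ζ ^ 2 * (p * |(Q 2 : ℝ)|) := by ring
      _ ≤ p * p + |ζ| * F + ζ ^ 2 * F := by gcongr
      _ = _ := by ring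
  have hQ : p * ‖Q‖ ≤ p * p + (1 + |ζ| + ζ ^ 2) * F := by
    obtain ⟨k, hk⟩ := exists_norm_eq_abs_apply Q
    have z1 : 0 ≤ p * p := by positivity
    have z2 : 0 ≤ |ζ| * F := by positivity
    have z3 : 0 ≤ ζ ^ 2 * F := by positivity
    rw [hk]
    fin_cases k <;> simp only [Fin.zero_eta, Fin.mk_one, Fin.reduceFinMk] <;> linarith
  have hpp : p * p ≤ p * ((1 + |ζ| + ζ ^ 2) * ‖P‖) := by gcongr
  have hnn : p * (4 * (1 + |ζ| + ζ ^ 2) * ‖P‖) ≤ p * ‖Q‖ := by gcongr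
  rw [hF] at hQ
  linarith

namespace IsMinSeq

variable {ζ : ℝ} {P : ℕ → Fin 3 → ℤ}

lemma strictMono_norm (hP : IsMinSeq ζ P) : StrictMono fun i => ‖P i‖ := strictMono_nat_of_lt_succ hP.norm_lt

lemma strictAnti_eval (hP : IsMinSeq ζ P) : StrictAnti fun i => |quadEval ζ (P i)| :=
  strictAnti_nat_of_succ_lt hP.eval_lt

lemma tendsto_norm (hP : IsMinSeq ζ P) :
    Filter.Tendsto (fun i => ‖P i‖) Filter.atTop Filter.atTop := by
  refine Filter.tendsto_atTop_mono (f := fun i : ℕ => (i : ℝ)) (fun i => ?_)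
    tendsto_natCast_atTop_atTop
  induction i with
  | zero => simp
  | succ i ih =>
    have h := hP.norm_lt i
    obtain ⟨a, ha⟩ := exists_norm_eq_natCast (P i)
    obtain ⟨b, hb⟩ := exists_norm_eq_natCast (P (i + 1))
    rw [ha] at ih h
    rw [hb] at h ⊢
    norm_cast at *
    omega

lemma norm_pos (hP : IsMinSeq ζ P) (i : ℕ) : 0 < ‖P i‖ := norm_pos_iff.mpr (hP.ne_zero i)

lemma eval_pos (hP : IsMinSeq ζ P) (i : ℕ) : 0 < |quadEval ζ (P i)| :=
  (abs_nonneg _).trans_lt (hP.eval_lt i)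

lemma log_norm_pos (hP : IsMinSeq ζ P) (i : ℕ) : 0 ≤ Real.log ‖P i‖ :=
  Real.log_nonneg (one_le_norm_of_ne_zero (hP.ne_zero i))

lemma tendsto_log_norm (hP : IsMinSeq ζ P) :
    Filter.Tendsto (fun i => Real.log ‖P i‖) Filter.atTop Filter.atTop :=
  Real.tendsto_log_atTop.comp hP.tendsto_norm

lemma eventually_log_eval_le (hP : IsMinSeq ζ P) {ω : ℝ} (hU : QuadUniform ζ ω) :
    ∃ i₀, ∀ i ≥ i₀, Real.log |quadEval ζ (P i)| ≤
      -ω * Real.log ‖P (i + 1)‖ + ω * Real.log 2 := by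
  obtain ⟨X₀, hX₀⟩ := hU
  obtain ⟨i₀, hi₀⟩ := Filter.eventually_atTop.mp
    (hP.tendsto_norm.eventually (Filter.eventually_ge_atTop (2 * X₀)))
  refine ⟨i₀, fun i hi => ?_⟩
  have hpos := hP.norm_pos (i + 1)
  obtain ⟨R, h0, h1, h2⟩ := hX₀ (‖P (i + 1)‖ / 2) (by have := hi₀ (i + 1) (by omega); linarith)
  have h3 := (hP.le_eval i R h0 (by linarith)).trans h2
  have h4 := Real.log_le_log (hP.eval_pos i) h3
  rw [Real.log_rpow (by positivity), Real.log_div hpos.ne' two_ne_zero] at h4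
  linarith

lemma eventually_quadRes_ne_zero (hP : IsMinSeq ζ P) (hirr : Irrational ζ) {ω : ℝ} (hω : 2 < ω)
    (hU : QuadUniform ζ ω) : ∃ i₀, ∀ i ≥ i₀, ∀ j > i, quadRes (P i) (P j) ≠ 0 := by
  obtain ⟨c, hc, hred⟩ := exists_lower_bound_reducible hirr hU hω
  obtain ⟨i₁, hi₁⟩ := hP.eventually_log_eval_le hU
  obtain ⟨i₂, hi₂⟩ := Filter.eventually_atTop.mp
    (hP.tendsto_log_norm.eventually
      (Filter.eventually_gt_atTop ((ω * Real.log 2 - Real.log c) / (ω - 2))))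
  refine ⟨max i₁ i₂, fun i hi j hj h => ?_⟩
  have h1 := hred (P i) (hP.ne_zero i) (reducible_of_quadRes_eq_zero
    (quadWedge_ne_zero (hP.strictMono_norm hj) (hP.strictAnti_eval hj)) h)
  have h2 := Real.log_le_log hc h1
  have hpos := hP.norm_pos i
  rw [Real.log_mul (by positivity) (hP.eval_pos i).ne', Real.log_pow] at h2
  push_cast at h2
  have h3 := hi₁ i ((le_max_left _ _).trans hi)
  have h4 := hi₂ i ((le_max_right _ _).trans hi)
  rw [div_lt_iff₀ (by linarith)] at h4
  have h5 : Real.log ‖P i‖ ≤ Real.log ‖P (i + 1)‖ := Real.log_le_log hpos (hP.norm_lt i).le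
  nlinarith

lemma neg_log_eval_le (hP : IsMinSeq ζ P) {i j : ℕ} (hij : i < j)
    (h : quadRes (P i) (P j) ≠ 0) :
    -Real.log |quadEval ζ (P i)| ≤ Real.log ‖P i‖ + 2 * Real.log ‖P j‖ +
      Real.log (16 * (1 + |ζ| + ζ ^ 2)) := by
  have h1 := Real.log_nonneg (one_le_of_quadRes_ne_zero (hP.strictMono_norm hij).le
    (hP.strictAnti_eval hij).le h)
  have := hP.norm_pos i
  have := hP.norm_pos j
  have := hP.eval_pos i
  have : 0 ≤ |ζ| := abs_nonneg _
  rw [Real.log_mul (by positivity) (by positivity),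
    Real.log_mul (y := ‖P j‖ ^ 2) (by positivity) (by positivity),
    Real.log_mul (y := ‖P i‖) (by positivity) (by positivity), Real.log_pow] at h1
  push_cast at h1
  linarith

lemma neg_log_eval_le_of_quadDet_ne_zero (hP : IsMinSeq ζ P) {k : ℕ}
    (h : quadDet (P k) (P (k + 1)) (P (k + 2)) ≠ 0) :
    -Real.log |quadEval ζ (P k)| ≤ Real.log ‖P (k + 1)‖ + Real.log ‖P (k + 2)‖ +
      Real.log 6 := by
  have h1 := Real.log_nonneg (one_le_of_quadDet_ne_zero (hP.norm_lt k).le (hP.norm_lt (k + 1)).le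
    (hP.eval_lt k).le (hP.eval_lt (k + 1)).le h)
  have := hP.norm_pos (k + 1)
  have := hP.norm_pos (k + 2)
  have := hP.eval_pos k
  rw [Real.log_mul (by positivity) (by positivity), Real.log_mul (by positivity) (by positivity),
    Real.log_mul (by positivity) (by positivity)] at h1
  linarith

lemma exists_quadDet_ne_zero (hP : IsMinSeq ζ P) (hirr : Irrational ζ) {ω : ℝ} (hω : 2 < ω)
    (hU : QuadUniform ζ ω) (j : ℕ) : ∃ k ≥ j, quadDet (P k) (P (k + 1)) (P (k + 2)) ≠ 0 := by
  by_contra! hall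
  have hb := fun d => abs_mul_le_of_int_mul hP j d fun k hk _ => hall k hk
  obtain ⟨i₁, hi₁⟩ := hP.eventually_log_eval_le hU
  have hsmall : ∀ ε > 0, ∃ d, 2 * (|quadEval ζ (P (j + d))| * ‖P (j + d + 1)‖) < ε := by
    intro ε hε
    obtain ⟨i₂, hi₂⟩ := Filter.eventually_atTop.mp
      (hP.tendsto_log_norm.eventually
        (Filter.eventually_gt_atTop ((ω * Real.log 2 + Real.log 2 - Real.log ε) / (ω - 1))))
    refine ⟨i₁ + i₂, ?_⟩
    have h1 := hi₁ (j + (i₁ + i₂)) (by omega)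
    have h2 := hi₂ (j + (i₁ + i₂) + 1) (by omega)
    have p1 := hP.eval_pos (j + (i₁ + i₂))
    have p2 := hP.norm_pos (j + (i₁ + i₂) + 1)
    rw [div_lt_iff₀ (by linarith)] at h2
    rw [← Real.log_lt_log_iff (by positivity) hε, Real.log_mul (by positivity) (by positivity),
      Real.log_mul (by positivity) (by positivity)]
    nlinarith
  have hzero : ∀ a : ℝ, (∀ d, |a| ≤ 2 * (|quadEval ζ (P (j + d))| * ‖P (j + d + 1)‖)) → a = 0 := by
    intro a ha
    by_contra h0
    obtain ⟨d, hd⟩ := hsmall |a| (abs_pos.mpr h0)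
    exact absurd (ha d) (not_le.mpr hd)
  have e1 := hzero _ fun d => (hb d).1
  have e2 := hzero _ fun d => (hb d).2
  have x0 : quadWedge (P j) (P (j + 1)) 0 = 0 := by
    by_contra h0
    refine ((hirr.mul_intCast h0).sub_intCast (quadWedge (P j) (P (j + 1)) 1)).ne_zero e1
  rw [x0] at e1 e2
  refine quadWedge_ne_zero (hP.norm_lt j) (hP.eval_lt j) ?_
  ext c
  fin_cases c
  · exact x0
  · simpa using e1
  · simpa using e2

end IsMinSeq

/-- A sequence of quadratic polynomials with geometrically growing logarithmic heights and nearly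
optimal values at `ζ`, any two consecutive ones being coprime. -/
structure IsQuadChain (ζ δ : ℝ) (Q : ℕ → Fin 3 → ℤ) : Prop where
  tendsto : Filter.Tendsto (fun m => log ‖Q m‖) Filter.atTop Filter.atTop
  ne_zero : ∀ m, Q m ≠ 0
  norm_lt : ∀ m, ‖Q m‖ < ‖Q (m + 1)‖
  eval_lt : ∀ m, |quadEval ζ (Q (m + 1))| < |quadEval ζ (Q m)|
  le_log : ∀ m, (goldenRatio - δ) * log ‖Q m‖ ≤ log ‖Q (m + 1)‖
  log_le : ∀ m, log ‖Q (m + 1)‖ ≤ (goldenRatio + δ) * log ‖Q m‖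
  log_eval_le : ∀ m, log |quadEval ζ (Q m)| ≤ -(goldenRatio + 1 - δ) * log ‖Q (m + 1)‖
  quadRes_ne_zero : ∀ m, quadRes (Q m) (Q (m + 1)) ≠ 0

lemma exists_consecutive_seq {p : ℕ → Prop} (h : ∀ j, ∃ k ≥ j, p k) (i₀ : ℕ) :
    ∃ f : ℕ → ℕ, StrictMono f ∧ (∀ m, i₀ ≤ f m) ∧ (∀ m, p (f m)) ∧
      ∀ m k, f m < k → k < f (m + 1) → ¬ p k := by
  classical
  let q : ℕ → Prop := fun k => i₀ ≤ k ∧ p k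
  have hq : {k | q k}.Infinite := by
    rw [Set.infinite_iff_exists_gt]
    intro a
    obtain ⟨k, hk, hpk⟩ := h (max i₀ (a + 1))
    exact ⟨k, ⟨(le_max_left _ _).trans hk, hpk⟩, (le_max_right _ _).trans hk⟩
  have hmono := Nat.nth_strictMono hq
  refine ⟨Nat.nth q, hmono, fun m => (Nat.nth_mem_of_infinite hq m).1,
    fun m => (Nat.nth_mem_of_infinite hq m).2, fun m k h1 h2 hp => ?_⟩
  have hk : q k := ⟨(Nat.nth_mem_of_infinite hq m).1.trans h1.le, hp⟩
  rw [← Nat.nth_count hk] at h1 h2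
  have := hmono.lt_iff_lt.mp h1
  have := hmono.lt_iff_lt.mp h2
  omega

lemma IsMinSeq.exists_consecutive_bounds {ζ : ℝ} {P : ℕ → Fin 3 → ℤ} (hP : IsMinSeq ζ P)
    (hirr : Irrational ζ) {ω : ℝ} (hω : 2 < ω) (hU : QuadUniform ζ ω) :
    ∃ K : ℝ, 0 < K ∧ ∃ i₀, ∀ k ≥ i₀, ∀ k' > k,
      quadDet (P k) (P (k + 1)) (P (k + 2)) ≠ 0 →
      (∀ i, k < i → i < k' → quadDet (P i) (P (i + 1)) (P (i + 2)) = 0) →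
      (ω - 1) * log ‖P (k + 1)‖ - K ≤ log ‖P (k + 2)‖ ∧
      (ω - 1) * log ‖P (k' + 1)‖ ≤ log ‖P (k + 1)‖ + log ‖P (k + 2)‖ + K ∧
      log ‖P (k + 2)‖ ≤ log ‖P (k' + 1)‖ ∧
      log |quadEval ζ (P (k + 1))| ≤ -ω * log ‖P (k + 2)‖ + K ∧
      quadRes (P (k + 1)) (P (k' + 1)) ≠ 0 := by
  have hM : 1 ≤ 1 + |ζ| + ζ ^ 2 := by have := abs_nonneg ζ; nlinarith [sq_nonneg ζ]
  have K1 : 0 < ω * log 2 := mul_pos (by linarith) (Real.log_pos (by norm_num))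
  have K2 : 0 < log (16 * (1 + |ζ| + ζ ^ 2)) := Real.log_pos (by linarith)
  have K3 : 0 < log 6 := Real.log_pos (by norm_num)
  have K4 : 0 < log (4 * (1 + |ζ| + ζ ^ 2)) := Real.log_pos (by linarith)
  obtain ⟨i₁, hi₁⟩ := hP.eventually_log_eval_le hU
  obtain ⟨i₂, hi₂⟩ := hP.eventually_quadRes_ne_zero hirr hω hU
  obtain ⟨i₃, hi₃⟩ := Filter.eventually_atTop.mp
    (hP.tendsto_log_norm.eventually (Filter.eventually_ge_atTop
      ((ω * log 2 + log 6 + log (4 * (1 + |ζ| + ζ ^ 2))) / (ω - 2))))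
  refine ⟨ω * log 2 + log (16 * (1 + |ζ| + ζ ^ 2)) + log 6 + log (4 * (1 + |ζ| + ζ ^ 2)),
    by positivity, i₁ + i₂ + i₃, fun k hk k' hkk' hdet hzero => ?_⟩
  have hA : (ω - 1) * log ‖P (k + 1)‖ - (ω * log 2 + log 6) ≤ log ‖P (k + 2)‖ := by
    have h1 := hi₁ k (by omega)
    have h2 := hP.neg_log_eval_le_of_quadDet_ne_zero hdet
    linarith
  have hlarge : 4 * (1 + |ζ| + ζ ^ 2) * ‖P (k + 1)‖ ≤ ‖P (k + 2)‖ := by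
    have p1 := hP.norm_pos (k + 1)
    have h3 := hi₃ (k + 1) (by omega)
    rw [div_le_iff₀ (by linarith)] at h3
    rw [← Real.log_le_log_iff (by positivity) (hP.norm_pos _),
      Real.log_mul (by positivity) p1.ne']
    linarith
  obtain ⟨d, rfl⟩ := Nat.exists_eq_add_of_lt hkk'
  have e : k + 1 + d = k + d + 1 := by omega
  obtain ⟨b1, b2⟩ := abs_mul_le_of_int_mul hP (k + 1) d fun i h1 h2 => hzero i (by omega) (by omega)
  have hb := abs_mul_norm_le (hP.eval_lt (k + 1)).le hlarge b1 b2
  rw [e] at hb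
  have p1 := hP.eval_pos (k + 1)
  have p2 := hP.norm_pos (k + 2)
  have p3 := hP.eval_pos (k + d + 1)
  have p4 := hP.norm_pos (k + d + 1 + 1)
  rw [show ∀ a b : ℝ, 2 * a * (2 * b) = 4 * a * b by intros; ring] at hb
  have hb' := Real.log_le_log (mul_pos p1 p2) hb
  rw [Real.log_mul p1.ne' p2.ne', Real.log_mul (by positivity) (mul_pos p3 p4).ne',
    Real.log_mul p3.ne' p4.ne'] at hb'
  have c1 := hi₁ (k + d + 1) (by omega)
  have c2 := hP.neg_log_eval_le (show k + 1 < k + 2 by omega) (hi₂ _ (by omega) _ (by omega))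
  have c3 := hi₁ (k + 1) (by omega)
  refine ⟨by linarith, by linarith, ?_, ?_, hi₂ _ (by omega) _ (by omega)⟩
  · exact Real.log_le_log p2 (hP.strictMono_norm.monotone (by omega : k + 2 ≤ k + d + 1 + 1))
  · have : k + 1 + 1 = k + 2 := rfl
    rw [this] at c3
    linarith

lemma aeval_ofFn_eq_sum (ζ : ℝ) {n : ℕ} (v : Fin n → ℤ) :
    Polynomial.aeval ζ (Polynomial.ofFn n v) = ∑ i : Fin n, (v i : ℝ) * ζ ^ (i : ℕ) := by
  simp [Polynomial.ofFn_eq_sum_monomial, Polynomial.aeval_monomial]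

lemma eq_zero_of_sum_mul_pow_eq_zero {ζ : ℝ} (hζ : Transcendental ℚ ζ) {n : ℕ} (v : Fin n → ℤ)
    (h : ∑ i : Fin n, (v i : ℝ) * ζ ^ (i : ℕ) = 0) : v = 0 := by
  have hZ : Transcendental ℤ ζ := hζ.restrictScalars Int.cast_injective
  rw [← aeval_ofFn_eq_sum] at h
  have h0 := transcendental_iff.mp hZ _ h
  exact Polynomial.injective_ofFn n (h0.trans (Polynomial.ofFn_zero n).symm)

lemma exists_isQuadChain {ζ : ℝ} (hζ : IsExtremal ζ) {δ : ℝ} (hδ : 0 < δ) (hδ1 : δ ≤ 1 / 10) :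
    ∃ Q, IsQuadChain ζ δ Q := by
  have hirr : Irrational ζ := by
    rintro ⟨r, rfl⟩
    exact hζ.1 (isAlgebraic_algebraMap r)
  have hind : ∀ P : Fin 3 → ℤ, quadEval ζ P = 0 → P = 0 := by
    intro P h
    refine eq_zero_of_sum_mul_pow_eq_zero hζ.1 P ?_
    simp only [Fin.sum_univ_three, Fin.val_zero, Fin.val_one, Fin.val_two, pow_zero, pow_one, mul_one]
    exact h
  have hg := Real.goldenRatio_sq
  have hg1 : (1.6 : ℝ) < goldenRatio := by
    have : (2.2 : ℝ) < √5 := Real.lt_sqrt_of_sq_lt (by norm_num)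
    rw [goldenRatio]; linarith
  have hg2 : goldenRatio < (1.7 : ℝ) := by
    have : √5 < (2.4 : ℝ) := by rw [Real.sqrt_lt' (by norm_num)]; norm_num
    rw [goldenRatio]; linarith
  set g := goldenRatio
  set d := δ / 20 with hd
  have hU : QuadUniform ζ (g + 1 - d) := quadUniform_of_isExtremal hζ (by simp only [g]; linarith)
  obtain ⟨P, hP⟩ := exists_isMinSeq hind hU (by linarith)
  obtain ⟨K, hK, i₀, hi₀⟩ := hP.exists_consecutive_bounds hirr (by linarith) hU
  obtain ⟨i₁, hi₁⟩ := Filter.eventually_atTop.mp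
    (hP.tendsto_log_norm.eventually (Filter.eventually_ge_atTop (40 * K / δ)))
  obtain ⟨f, hf, hf0, hfdet, hfzero⟩ :=
    exists_consecutive_seq (hP.exists_quadDet_ne_zero hirr (by linarith) hU) (i₀ + i₁)
  have hB := fun m => hi₀ (f m) (by have := hf0 m; omega) (f (m + 1)) (hf (by omega)) (hfdet m)
    fun i h1 h2 => not_not.mp (hfzero m i h1 h2)
  have hlarge : ∀ m, 40 * K ≤ log ‖P (f m + 1)‖ * δ := by
    intro m
    have := hi₁ (f m + 1) (by have := hf0 m; omega)
    rwa [div_le_iff₀ hδ] at this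
  have hlt : ∀ m, f m + 1 < f (m + 1) + 1 := fun m => by have := hf (Nat.lt_add_one m); omega
  refine ⟨fun m => P (f m + 1), ⟨?_, fun m => hP.ne_zero _, fun m => hP.strictMono_norm (hlt m),
    fun m => hP.strictAnti_eval (hlt m), fun m => ?_, fun m => ?_, fun m => ?_,
    fun m => (hB m).2.2.2.2⟩⟩
  · exact hP.tendsto_log_norm.comp ((Filter.tendsto_add_atTop_nat 1).comp hf.tendsto_atTop)
  all_goals
    obtain ⟨b1, b2, b3, b4, -⟩ := hB m
    have l1 := hlarge m
    have l2 := hlarge (m + 1)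
    have y1 := hP.log_norm_pos (f m + 1)
    have y2 := hP.log_norm_pos (f (m + 1) + 1)
    set y := log ‖P (f m + 1)‖
    set y' := log ‖P (f (m + 1) + 1)‖
    set z := log ‖P (f m + 2)‖
    have m1 : 0 ≤ y * δ := by positivity
    have m2 : 0 ≤ y' * δ := by positivity
  · rw [hd] at b1
    linarith
  · have hc : (g - 1 - d) * y' ≤ (g - 1 - d) * ((g + δ) * y) := by
      have h1 : 1 + 0.4 * δ ≤ (g - 1 - d) * (g + δ) := by
        have : (g - 1 - d) * (g + δ) = 1 + δ * (g - 1 - (g + δ) / 20) := by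
          rw [hd]; linear_combination hg
        rw [this]
        nlinarith
      have h2 : (1 + 0.4 * δ) * y ≤ (g - 1 - d) * (g + δ) * y := by gcongr
      linarith
    exact le_of_mul_le_mul_left hc (by linarith)
  · have hy : y ≤ (g - 1 + d) * (y' + K) := by
      have h1 : 1 ≤ (g - 1 + d) * (g - d) := by
        have : (g - 1 + d) * (g - d) = 1 + d * (1 - d) := by linear_combination hg
        rw [this]
        nlinarith
      have h2 : (g - 1 + d) * ((g + 1 - d - 1) * y) ≤ (g - 1 + d) * (y' + K) :=
        mul_le_mul_of_nonneg_left (by linarith) (by linarith)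
      have h3 : 1 * y ≤ (g - 1 + d) * (g - d) * y := by gcongr
      linarith
    have hgd : (g - 1 + d) * K ≤ 1 * K := by gcongr; linarith
    have hz : (1 - 2 * d) * y' - 2 * K ≤ z := by linarith
    have h4 : (g + 1 - d) * ((1 - 2 * d) * y' - 2 * K) ≤ (g + 1 - d) * z := by
      gcongr; linarith
    have h5 : (g + 1 - d) * (2 * K) ≤ 3 * (2 * K) := by gcongr; linarith
    have h6 : (g + 1 - d) * (1 - 2 * d) = g + 1 - δ * ((1 + 2 * (g + 1 - d)) / 20) := by
      rw [hd]; ring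
    have h7 : δ * y' * ((1 + 2 * (g + 1 - d)) / 20) ≤ δ * y' * (1 / 2) :=
      mul_le_mul_of_nonneg_left (by linarith) (by linarith)
    have h8 : (g + 1 - d) * ((1 - 2 * d) * y') = (g + 1) * y' - δ * y' * ((1 + 2 * (g + 1 - d)) / 20) := by
      rw [← mul_assoc, h6]; ring
    linarith

lemma irrational_of_transcendental {ζ : ℝ} (hζ : Transcendental ℚ ζ) : Irrational ζ := by
  rintro ⟨r, rfl⟩
  exact hζ (isAlgebraic_algebraMap r)

lemma goldenRatio_gt : (1.6 : ℝ) < goldenRatio := by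
  have : (2.2 : ℝ) < √5 := Real.lt_sqrt_of_sq_lt (by norm_num)
  rw [goldenRatio]; linarith

lemma goldenRatio_lt : goldenRatio < (1.65 : ℝ) := by
  have : √5 < (2.3 : ℝ) := by rw [Real.sqrt_lt' (by norm_num)]; norm_num
  rw [goldenRatio]; linarith

lemma exists_isQuadChain_le {ζ : ℝ} (hζ : IsExtremal ζ) {δ : ℝ} (hδ : 0 < δ) (hδ1 : δ ≤ 1 / 10)
    (Y : ℝ) : ∃ Q, IsQuadChain ζ δ Q ∧ ∀ m, Y ≤ log ‖Q m‖ := by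
  obtain ⟨Q, hQ⟩ := exists_isQuadChain hζ hδ hδ1
  obtain ⟨n, hn⟩ := Filter.eventually_atTop.mp
    (hQ.tendsto.eventually (Filter.eventually_ge_atTop Y))
  refine ⟨fun m => Q (m + n), ⟨hQ.tendsto.comp (Filter.tendsto_add_atTop_nat n),
    fun m => hQ.ne_zero _, fun m => ?_, fun m => ?_, fun m => ?_, fun m => ?_, fun m => ?_,
    fun m => ?_⟩, fun m => hn _ (by omega)⟩
  all_goals rw [show m + 1 + n = m + n + 1 by omega]
  · exact hQ.norm_lt _
  · exact hQ.eval_lt _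
  · exact hQ.le_log _
  · exact hQ.log_le _
  · exact hQ.log_eval_le _
  · exact hQ.quadRes_ne_zero _

lemma exists_le_lt_succ {f : ℕ → ℝ} (hf : Filter.Tendsto f Filter.atTop Filter.atTop) {t : ℝ}
    (h0 : f 0 ≤ t) : ∃ m, f m ≤ t ∧ t < f (m + 1) := by
  by_contra! h
  have hall : ∀ m, f m ≤ t := fun m => by
    induction m with
    | zero => exact h0
    | succ m ih => exact h m ih
  obtain ⟨m, hm⟩ := (hf.eventually (Filter.eventually_gt_atTop t)).exists
  exact absurd (hall m) (not_le.mpr hm)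

namespace IsQuadChain

variable {ζ δ : ℝ} {Q : ℕ → Fin 3 → ℤ}

lemma norm_eq_exp (hQ : IsQuadChain ζ δ Q) (m : ℕ) : ‖Q m‖ = exp (log ‖Q m‖) :=
  (Real.exp_log (norm_pos_iff.mpr (hQ.ne_zero m))).symm

lemma eval_pos (hQ : IsQuadChain ζ δ Q) (m : ℕ) : 0 < |quadEval ζ (Q m)| :=
  (abs_nonneg _).trans_lt (hQ.eval_lt m)

lemma eval_le_exp (hQ : IsQuadChain ζ δ Q) (m : ℕ) :
    |quadEval ζ (Q m)| ≤ exp (-(goldenRatio + 1 - δ) * log ‖Q (m + 1)‖) :=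
  (Real.log_le_iff_le_exp (hQ.eval_pos m)).mp (hQ.log_eval_le m)

lemma log_nonneg (hQ : IsQuadChain ζ δ Q) (m : ℕ) : 0 ≤ log ‖Q m‖ :=
  Real.log_nonneg (one_le_norm_of_ne_zero (hQ.ne_zero m))

lemma log_le_mul_succ (hQ : IsQuadChain ζ δ Q) (hδ : 0 < δ) (hδ1 : δ ≤ 1 / 10) (m : ℕ) :
    log ‖Q m‖ ≤ (goldenRatio - 1 + δ) * log ‖Q (m + 1)‖ := by
  have hg := Real.goldenRatio_sq
  have hg1 := goldenRatio_gt
  have h1 := hQ.log_nonneg m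
  have h2 := hQ.le_log m
  have e : (goldenRatio - 1 + δ) * (goldenRatio - δ) = 1 + δ * (1 - δ) := by
    linear_combination hg
  have h3 : (goldenRatio - 1 + δ) * ((goldenRatio - δ) * log ‖Q m‖) ≤
      (goldenRatio - 1 + δ) * log ‖Q (m + 1)‖ := by gcongr; linarith
  rw [← mul_assoc, e] at h3
  have h4 : 0 ≤ δ * (1 - δ) * log ‖Q m‖ := by
    have : 0 ≤ 1 - δ := by linarith
    positivity
  linarith

lemma wedge_bounds (hQ : IsQuadChain ζ δ Q) (hδ : 0 < δ) (hδ1 : δ ≤ 1 / 10) (m : ℕ)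
    (hY : log 2 ≤ δ * log ‖Q (m + 1)‖) :
    |(quadWedge (Q m) (Q (m + 1)) 0 : ℝ)| ≤ exp ((goldenRatio + 2 * δ) * log ‖Q (m + 1)‖) ∧
    |ζ * quadWedge (Q m) (Q (m + 1)) 0 - quadWedge (Q m) (Q (m + 1)) 1| ≤
      exp (-(goldenRatio - 2 * δ) * log ‖Q (m + 1)‖) ∧
    |ζ ^ 2 * quadWedge (Q m) (Q (m + 1)) 0 - quadWedge (Q m) (Q (m + 1)) 2| ≤
      exp (-(goldenRatio - 2 * δ) * log ‖Q (m + 1)‖) := by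
  obtain ⟨h1, h2⟩ := abs_quadWedge_sub_le (hQ.norm_lt m).le (hQ.eval_lt m).le
  have h0 := abs_quadWedge_le (Q m) (Q (m + 1)) 0
  have hb : 2 * (|quadEval ζ (Q m)| * ‖Q (m + 1)‖) ≤
      exp (-(goldenRatio - 2 * δ) * log ‖Q (m + 1)‖) := by
    have h3 := hQ.eval_le_exp m
    calc 2 * (|quadEval ζ (Q m)| * ‖Q (m + 1)‖)
        ≤ exp (log 2) * (exp (-(goldenRatio + 1 - δ) * log ‖Q (m + 1)‖) *
          exp (log ‖Q (m + 1)‖)) := by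
          rw [← hQ.norm_eq_exp, Real.exp_log two_pos]; gcongr
      _ = exp (log 2 + (-(goldenRatio + 1 - δ) * log ‖Q (m + 1)‖ + log ‖Q (m + 1)‖)) := by
          rw [Real.exp_add, Real.exp_add]
      _ ≤ _ := Real.exp_le_exp.mpr (by linarith)
  refine ⟨h0.trans ?_, h1.trans hb, h2.trans hb⟩
  have h4 := hQ.log_le_mul_succ hδ hδ1 m
  calc 2 * (‖Q m‖ * ‖Q (m + 1)‖) = exp (log 2 + (log ‖Q m‖ + log ‖Q (m + 1)‖)) := by
        rw [Real.exp_add, Real.exp_add, ← hQ.norm_eq_exp, ← hQ.norm_eq_exp, Real.exp_log two_pos]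
    _ ≤ _ := Real.exp_le_exp.mpr (by linarith)

end IsQuadChain

set_option maxHeartbeats 1000000 in
lemma exists_lower_bound_linear {ζ : ℝ} (hζ : IsExtremal ζ) {η : ℝ} (hη : 0 < η) (hη1 : η ≤ 1) :
    ∃ C, ∀ q : ℕ, 0 < q → ∀ p : ℤ, exp (-C - (1 + η) * log q) ≤ |q * ζ - p| := by
  have hirr := irrational_of_transcendental hζ.1
  set g := goldenRatio with hgdef
  have hg1 : 1.6 < g := goldenRatio_gt
  have hg2 : g < 1.65 := goldenRatio_lt
  set δ := η / 50 with hδdef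
  have hδ : 0 < δ := by positivity
  have hδ1 : δ ≤ 1 / 50 := by rw [hδdef]; linarith
  have hn1 : g + δ ≤ (1 + 4 * δ) * (g - 3 * δ) := by nlinarith
  have hn2 : (g + 2 * δ) * (1 + 4 * δ) ≤ 2 := by nlinarith
  have h5 : (η * g + 2 * δ * (2 + η)) * (1 + 4 * δ) ≤ 2 * η + η ^ 2 := by
    have e : η = 50 * δ := by rw [hδdef]; ring
    rw [e]
    have h5 : (50 * g + 4 + 100 * δ) * (1 + 4 * δ) ≤ 100 + 2500 * δ := by nlinarith
    have := mul_le_mul_of_nonneg_left h5 hδ.le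
    linarith
  set K := 4 + 4 * |ζ| with hK
  have hK4 : 4 ≤ K := by have := abs_nonneg ζ; linarith
  have hK0 : 0 < log K := Real.log_pos (by linarith)
  obtain ⟨Q, hQ, hQY⟩ := exists_isQuadChain_le hζ hδ (by linarith) ((log 2 + log K) / δ)
  have hl2 : 0 < log 2 := Real.log_pos (by norm_num)
  have hY : ∀ m, log 2 + log K ≤ δ * log ‖Q m‖ := fun m => by
    have := hQY m
    rw [div_le_iff₀ hδ] at this
    linarith
  obtain ⟨D, hD⟩ := exists_nat_ge (exp ((g - 3 * δ) * log ‖Q 0‖))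
  obtain ⟨c, hc, hcD⟩ := exists_pos_le_abs_mul_sub hirr D
  set C := max (max (-log c) (log 2)) ((log K + 2 * log 2) / η + 1) with hC
  have hC1 : -log c ≤ C := (le_max_left _ _).trans (le_max_left _ _)
  have hC2 : log 2 ≤ C := (le_max_right _ _).trans (le_max_left _ _)
  have hC3 : log K + 2 * log 2 < η * C := by
    have : (log K + 2 * log 2) / η < C := by
      have := le_max_right (max (-log c) (log 2)) ((log K + 2 * log 2) / η + 1)
      linarith
    rw [div_lt_iff₀ hη] at this
    linarith
  refine ⟨C, fun q => ?_⟩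
  induction q using Nat.strong_induction_on with
  | _ q ih =>
  intro hq p
  have hq1 : (1 : ℝ) ≤ q := by exact_mod_cast hq
  have hℓ : 0 ≤ log q := Real.log_nonneg hq1
  have hqe : (q : ℝ) = exp (log q) := (Real.exp_log (by linarith)).symm
  by_cases hqD : q ≤ D
  · refine le_trans ?_ (hcD q hq hqD p)
    rw [← Real.le_log_iff_exp_le hc]
    have : 0 ≤ (1 + η) * log q := by positivity
    linarith
  by_contra! ha
  have hlow : (g - 3 * δ) * log ‖Q 0‖ ≤ log q := by
    rw [Real.le_log_iff_exp_le (by linarith)]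
    exact hD.trans (by exact_mod_cast (not_le.mp hqD).le)
  obtain ⟨m, hm1, hm2⟩ := exists_le_lt_succ
    (hQ.tendsto.const_mul_atTop (show 0 < g - 3 * δ by linarith)) hlow
  obtain ⟨x0b, e1b, e2b⟩ := hQ.wedge_bounds hδ (by linarith) m (by have := hY (m + 1); linarith)
  have hres := hQ.quadRes_ne_zero m
  rw [quadRes_eq] at hres
  have hy0 := hQ.log_nonneg (m + 1)
  have hyY := hY (m + 1)
  have hyq : log ‖Q (m + 1)‖ ≤ (1 + 4 * δ) * log q := by
    have h1 := hQ.log_le m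
    have h2 := hQ.log_nonneg m
    calc log ‖Q (m + 1)‖ ≤ (g + δ) * log ‖Q m‖ := h1
      _ ≤ (1 + 4 * δ) * (g - 3 * δ) * log ‖Q m‖ := by gcongr
      _ = (1 + 4 * δ) * ((g - 3 * δ) * log ‖Q m‖) := by ring
      _ ≤ _ := by gcongr
  rw [← hgdef] at x0b e1b e2b
  generalize log ‖Q (m + 1)‖ = y at *
  generalize quadWedge (Q m) (Q (m + 1)) 0 = x0 at *
  generalize quadWedge (Q m) (Q (m + 1)) 1 = x1 at *
  generalize quadWedge (Q m) (Q (m + 1)) 2 = x2 at *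
  set L := exp (-(g - 2 * δ) * y) with hL
  have ha1 : |q * ζ - p| ≤ 1 := by
    refine ha.le.trans (Real.exp_le_one_iff.mpr ?_)
    have : 0 ≤ (1 + η) * log q := by positivity
    linarith
  have hqL : K * (q * L) ≤ 1 := by
    rw [← Real.exp_log (show 0 < K by linarith), hqe, hL, ← Real.exp_add, ← Real.exp_add,
      Real.exp_le_one_iff]
    linarith
  set u0 : ℤ := q * x1 - p * x0 with hu0
  set u1 : ℤ := q * x2 - p * x1 with hu1
  have hu : u0 ≠ 0 ∨ u1 ≠ 0 := by
    by_contra! h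
    obtain ⟨h0, h1⟩ := h
    rw [hu0] at h0
    rw [hu1] at h1
    have e : (q : ℤ) ^ 2 * (x1 ^ 2 - x2 * x0) = 0 := by
      linear_combination q * x1 * h0 - q * x0 * h1
    rcases mul_eq_zero.mp e with h1 | h1
    · have : (q : ℤ) ≠ 0 := by exact_mod_cast hq.ne'
      exact absurd h1 (pow_ne_zero 2 this)
    · exact hres h1
  have hL0 : 0 < L := Real.exp_pos _
  have hqL0 : 0 < q * L := by positivity
  have hζ0 := abs_nonneg ζ
  have hu1b : |(u0 : ℝ) * ζ - u1| ≤ K / 2 * (q * L) := by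
    have e : (u0 : ℝ) * ζ - u1 = (q * ζ - p) * (ζ * x0 - x1) + q * (ζ ^ 2 * x0 - x2)
        - 2 * ζ * q * (ζ * x0 - x1) := by
      rw [hu0, hu1]; push_cast; ring
    rw [e]
    calc _ ≤ |(q * ζ - p) * (ζ * x0 - x1) + q * (ζ ^ 2 * x0 - x2)| +
          |2 * ζ * q * (ζ * x0 - x1)| := abs_sub _ _
      _ ≤ |(q * ζ - p) * (ζ * x0 - x1)| + |q * (ζ ^ 2 * x0 - x2)| +
          |2 * ζ * q * (ζ * x0 - x1)| := by gcongr; exact abs_add_le _ _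
      _ = |q * ζ - p| * |ζ * x0 - x1| + q * |ζ ^ 2 * x0 - x2| +
          2 * |ζ| * q * |ζ * x0 - x1| := by
          simp only [abs_mul, abs_two, Nat.abs_cast]
      _ ≤ q * L + q * L + 2 * |ζ| * q * L := by gcongr; linarith
      _ = _ := by rw [hK]; ring
  have hu0b : |(u0 : ℝ)| ≤ |(x0 : ℝ)| * |q * ζ - p| + q * L := by
    have e : (u0 : ℝ) = x0 * (q * ζ - p) - q * (ζ * x0 - x1) := by
      rw [hu0]; push_cast; ring
    rw [e]
    refine (abs_sub _ _).trans ?_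
    rw [abs_mul, abs_mul, Nat.abs_cast]
    gcongr
  have hu0ne : u0 ≠ 0 := by
    intro h
    have h1 := hu.resolve_left (not_not.mpr h)
    have h2 : (1 : ℝ) ≤ |(u1 : ℝ)| := by exact_mod_cast Int.one_le_abs h1
    rw [h, Int.cast_zero, zero_mul, zero_sub, abs_neg] at hu1b
    linarith
  have hone : (1 : ℝ) ≤ |(u0 : ℝ)| := by exact_mod_cast Int.one_le_abs hu0ne
  have hu0lt : |(u0 : ℝ)| ≤ exp (log 2 + (g + 2 * δ) * y - C - (1 + η) * log q) := by
    have h1 : |(u0 : ℝ)| ≤ 2 * (|(x0 : ℝ)| * |q * ζ - p|) := by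
      have : 4 * (q * L) ≤ K * (q * L) := by gcongr
      linarith
    refine h1.trans ?_
    rw [show log 2 + (g + 2 * δ) * y - C - (1 + η) * log q =
      log 2 + ((g + 2 * δ) * y + (-C - (1 + η) * log q)) by ring, Real.exp_add, Real.exp_add,
      Real.exp_log two_pos]
    gcongr
  have hnat : ((u0.natAbs : ℕ) : ℝ) = |(u0 : ℝ)| := by rw [Nat.cast_natAbs]; push_cast; rfl
  have hlt : u0.natAbs < q := by
    have : (u0.natAbs : ℝ) < q := by
      rw [hnat]
      refine hu0lt.trans_lt ?_
      rw [hqe]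
      simp only [Real.log_exp]
      rw [Real.exp_lt_exp]
      have h1 : (g + 2 * δ) * y ≤ (g + 2 * δ) * ((1 + 4 * δ) * log q) := by gcongr
      have h2 : (g + 2 * δ) * (1 + 4 * δ) * log q ≤ 2 * log q := by
        gcongr
      have h3 : 0 ≤ η * log q := by positivity
      have h4 : η * C ≤ 1 * C := by gcongr
      linarith
    exact_mod_cast this
  have hih := ih _ hlt (Int.natAbs_pos.mpr hu0ne) (u0.sign * u1)
  rw [hnat] at hih
  have hsgn : |(|(u0 : ℝ)| * ζ - ((u0.sign * u1 : ℤ) : ℝ))| = |(u0 : ℝ) * ζ - u1| := by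
    rcases lt_or_gt_of_ne hu0ne with h | h
    · have h' : (u0 : ℝ) < 0 := by exact_mod_cast h
      rw [Int.sign_eq_neg_one_of_neg h, abs_of_neg h', ← abs_neg]
      congr 1; push_cast; ring
    · have h' : (0 : ℝ) < u0 := by exact_mod_cast h
      rw [Int.sign_eq_one_of_pos h, abs_of_pos h', one_mul]
  rw [hsgn] at hih
  have h1 : -C - (1 + η) * log |(u0 : ℝ)| ≤ log K + log q - (g - 2 * δ) * y := by
    rw [← Real.exp_le_exp]
    refine (hih.trans hu1b).trans ?_
    rw [show log K + log q - (g - 2 * δ) * y = log K + (log q + (-(g - 2 * δ) * y)) by ring,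
      Real.exp_add, Real.exp_add, Real.exp_log (by linarith : 0 < K), ← hqe, ← hL]
    gcongr
    linarith
  have h2 : log |(u0 : ℝ)| ≤ log 2 + (g + 2 * δ) * y - C - (1 + η) * log q :=
    (Real.log_le_iff_le_exp (by linarith)).mpr hu0lt
  have h3 : (1 + η) * log |(u0 : ℝ)| ≤ (1 + η) * (log 2 + (g + 2 * δ) * y - C - (1 + η) * log q) := by
    gcongr
  have h4 : (η * g + 2 * δ * (2 + η)) * y ≤ (η * g + 2 * δ * (2 + η)) * ((1 + 4 * δ) * log q) := by
    gcongr
  have h6 : (η * g + 2 * δ * (2 + η)) * (1 + 4 * δ) * log q ≤ (2 * η + η ^ 2) * log q := by gcongr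
  have h7 : η * log 2 ≤ 1 * log 2 := by gcongr
  linarith

lemma exists_pairs {ζ : ℝ} (hζ : IsExtremal ζ) {η : ℝ} (hη : 0 < η) (hη1 : η ≤ 1) :
    ∃ β₀, ∀ β ≥ β₀, ∃ q p q' p' : ℤ, |(q : ℝ)| ≤ exp β ∧ |(q' : ℝ)| ≤ exp β ∧
      |q * ζ - p| ≤ exp (-(1 - η) * β) ∧ |q' * ζ - p'| ≤ exp (-(1 - η) * β) ∧
      p * q' - p' * q ≠ 0 := by
  obtain ⟨C, hC⟩ := exists_lower_bound_linear hζ (half_pos hη) (by linarith)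
  refine ⟨2 * (|C| + 1) / η + |C| + 2, fun β hβ => ?_⟩
  have hC0 := abs_nonneg C
  have hβ1 : 2 * (|C| + 1) ≤ η * β := by
    have : 2 * (|C| + 1) / η ≤ β := by linarith
    rwa [div_le_iff₀ hη, mul_comm β] at this
  have hβ2 : |C| + 2 ≤ β := by
    have : 0 ≤ 2 * (|C| + 1) / η := by positivity
    linarith
  have hCC := le_abs_self C
  have hb1 : (1 : ℝ) ≤ exp β := Real.one_le_exp (by linarith)
  have hn : 0 < ⌊exp β⌋₊ := Nat.floor_pos.mpr hb1
  obtain ⟨r, hr, hrd⟩ := Real.exists_rat_abs_sub_le_and_den_le ζ hn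
  have hbound : ∀ (r : ℚ) (N : ℝ), |ζ - r| ≤ 1 / (N * r.den) → |r.den * ζ - r.num| ≤ 1 / N := by
    intro r N h
    have hd : (0 : ℝ) < r.den := by exact_mod_cast r.den_pos
    have e : r.den * ζ - r.num = r.den * (ζ - r) := by
      rw [mul_sub, mul_comm (r.den : ℝ) (r : ℝ)]
      congr 1
      exact_mod_cast (Rat.mul_den_eq_num r).symm
    rw [e, abs_mul, Nat.abs_cast]
    calc (r.den : ℝ) * |ζ - r| ≤ r.den * (1 / (N * r.den)) := by gcongr
      _ = 1 / N := by field_simp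
  have hfl : (⌊exp β⌋₊ : ℝ) ≤ exp β := Nat.floor_le (by linarith)
  have hr1 : |r.den * ζ - r.num| ≤ exp (-β) := by
    refine (hbound r _ hr).trans ?_
    rw [Real.exp_neg, ← one_div]
    exact one_div_le_one_div_of_le (Real.exp_pos _) (Nat.lt_floor_add_one _).le
  have hrb : (r.den : ℝ) ≤ exp β := le_trans (by exact_mod_cast hrd) hfl
  have hd0 : (0 : ℝ) < r.den := by exact_mod_cast r.den_pos
  have hlow := (hC r.den r.den_pos r.num).trans hr1
  rw [Real.exp_le_exp] at hlow
  have hlog : (1 - η) * β ≤ log r.den := by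
    have h1 : (1 + η / 2) * ((1 - η) * β) ≤ (1 + η / 2) * log r.den := by
      have : 0 ≤ η * (η * β) := mul_nonneg hη.le (by linarith)
      linarith
    exact le_of_mul_le_mul_left h1 (by linarith)
  have hden2 : 1 < r.den := by
    by_contra! h
    have h1 : r.den = 1 := le_antisymm h r.den_pos
    rw [h1] at hlow
    simp only [Nat.cast_one, Real.log_one, mul_zero, sub_zero] at hlow
    linarith
  obtain ⟨r', hr', hr'd⟩ := Real.exists_rat_abs_sub_le_and_den_le ζ (show 0 < r.den - 1 by omega)
  have hr'1 : |r'.den * ζ - r'.num| ≤ exp (-(1 - η) * β) := by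
    refine (hbound r' _ hr').trans ?_
    rw [neg_mul, Real.exp_neg, ← one_div, Nat.cast_sub hden2.le, Nat.cast_one, sub_add_cancel]
    refine one_div_le_one_div_of_le (Real.exp_pos _) ?_
    rwa [← Real.le_log_iff_exp_le hd0]
  refine ⟨r.den, r.num, r'.den, r'.num, ?_, ?_, ?_, ?_, ?_⟩
  · rwa [Int.cast_natCast, Nat.abs_cast]
  · rw [Int.cast_natCast, Nat.abs_cast]
    refine le_trans ?_ hrb
    have : r'.den ≤ r.den := by omega
    exact_mod_cast this
  · rw [Int.cast_natCast]
    refine hr1.trans (Real.exp_le_exp.mpr ?_)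
    have : 0 ≤ η * β := by linarith
    linarith
  · rwa [Int.cast_natCast]
  · intro h
    have hrr : r = r' := by
      rw [← Rat.num_div_den r, ← Rat.num_div_den r', div_eq_div_iff (by simp) (by simp)]
      exact_mod_cast sub_eq_zero.mp h
    rw [hrr] at hr'd
    have := r'.den_pos
    rw [hrr] at hden2
    omega

/-- The value at `ζ` of the cubic polynomial with coefficient vector `c`. -/
def cubEval (ζ : ℝ) (c : Fin 4 → ℤ) : ℝ := c 0 + c 1 * ζ + c 2 * ζ ^ 2 + c 3 * ζ ^ 3

/-- A quadratic polynomial viewed as a cubic one. -/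
def cubOfQuad (Q : Fin 3 → ℤ) : Fin 4 → ℤ := ![Q 0, Q 1, Q 2, 0]

/-- The product of a quadratic polynomial by the variable. -/
def cubShift (Q : Fin 3 → ℤ) : Fin 4 → ℤ := ![0, Q 0, Q 1, Q 2]

/-- The product of a quadratic polynomial by `q * T - p`. -/
def cubLin (q p : ℤ) (Q : Fin 3 → ℤ) : Fin 4 → ℤ :=
  ![-p * Q 0, q * Q 0 - p * Q 1, q * Q 1 - p * Q 2, q * Q 2]

/-- The determinant of a `3 × 3` matrix given by its columns. -/
def colDet {R : Type*} [CommRing R] (a b c : Fin 3 → R) : R :=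
  a 0 * (b 1 * c 2 - b 2 * c 1) + a 1 * (b 2 * c 0 - b 0 * c 2) + a 2 * (b 0 * c 1 - b 1 * c 0)

/-- The vector orthogonal to three given vectors in dimension `4` formed by their minors. -/
def cubCross (V : Fin 3 → Fin 4 → ℤ) : Fin 4 → ℤ :=
  ![colDet (fun i => V i 1) (fun i => V i 2) (fun i => V i 3),
    -colDet (fun i => V i 0) (fun i => V i 2) (fun i => V i 3),
    colDet (fun i => V i 0) (fun i => V i 1) (fun i => V i 3),
    -colDet (fun i => V i 0) (fun i => V i 1) (fun i => V i 2)]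

lemma abs_colDet_le {a b c A B C : Fin 3 → ℝ} (ha : ∀ i, |a i| ≤ A i) (hb : ∀ i, |b i| ≤ B i)
    (hc : ∀ i, |c i| ≤ C i) : |colDet a b c| ≤ A 0 * (B 1 * C 2 + B 2 * C 1) +
      A 1 * (B 2 * C 0 + B 0 * C 2) + A 2 * (B 0 * C 1 + B 1 * C 0) := by
  have hA : ∀ i, 0 ≤ A i := fun i => (abs_nonneg _).trans (ha i)
  refine (abs_add_three _ _ _).trans ?_
  simp only [abs_mul]
  gcongr
  · exact hA 0
  · exact ha 0
  · exact abs_mul_sub_mul_le (hb 1) (hc 2) (hb 2) (hc 1)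
  · exact hA 1
  · exact ha 1
  · exact abs_mul_sub_mul_le (hb 2) (hc 0) (hb 0) (hc 2)
  · exact hA 2
  · exact ha 2
  · exact abs_mul_sub_mul_le (hb 0) (hc 1) (hb 1) (hc 0)

lemma intCast_colDet (a b c : Fin 3 → ℤ) :
    ((colDet a b c : ℤ) : ℝ) = colDet (fun i => (a i : ℝ)) (fun i => (b i : ℝ))
      fun i => (c i : ℝ) := by
  simp only [colDet]; push_cast; ring

lemma cubCross_bounds {ζ T W : ℝ} {V : Fin 3 → Fin 4 → ℤ} {a b : Fin 3 → ℝ}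
    (ha : ∀ i, ‖V i‖ ≤ exp (a i)) (hb : ∀ i, |cubEval ζ (V i)| ≤ exp (b i))
    (hW : log 6 + a 0 + a 1 + a 2 ≤ W) (hT0 : log 6 + b 0 + a 1 + a 2 ≤ T)
    (hT1 : log 6 + b 1 + a 0 + a 2 ≤ T) (hT2 : log 6 + b 2 + a 0 + a 1 ≤ T) :
    |(cubCross V 0 : ℝ)| ≤ exp W ∧
      ∀ t : Fin 3, |ζ ^ ((t : ℕ) + 1) * cubCross V 0 - cubCross V t.succ| ≤ exp T := by
  have hV : ∀ k i, |(V i k : ℝ)| ≤ exp (a i) := fun k i => (abs_apply_le_norm (V i) k).trans (ha i)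
  have h6 : exp (log 6) = 6 := Real.exp_log (by norm_num)
  constructor
  · rw [show cubCross V 0 = colDet (fun i => V i 1) (fun i => V i 2) (fun i => V i 3) from rfl,
      intCast_colDet]
    refine (abs_colDet_le (hV 1) (hV 2) (hV 3)).trans ?_
    calc _ = exp (log 6 + a 0 + a 1 + a 2) := by simp only [Real.exp_add, h6]; ring
      _ ≤ exp W := Real.exp_le_exp.mpr hW
  · have key : ∀ j k, |colDet (fun i => cubEval ζ (V i)) (fun i => (V i j : ℝ))
        fun i => (V i k : ℝ)| ≤ exp T := by
      intro j k
      refine (abs_colDet_le hb (hV j) (hV k)).trans ?_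
      have e0 := Real.exp_le_exp.mpr hT0
      have e1 := Real.exp_le_exp.mpr hT1
      have e2 := Real.exp_le_exp.mpr hT2
      simp only [Real.exp_add, h6] at e0 e1 e2
      linarith
    intro t
    fin_cases t
    · refine le_trans (le_of_eq ?_) (key 2 3)
      congr 1
      simp [cubCross, colDet, cubEval]
      ring
    · refine le_trans (le_of_eq ?_) (key 1 3)
      rw [← abs_neg]
      congr 1
      simp [cubCross, colDet, cubEval]
      ring
    · refine le_trans (le_of_eq ?_) (key 1 2)
      congr 1
      simp [cubCross, colDet, cubEval]
      ring

lemma dotProduct_cubCross (u v w c : Fin 4 → ℤ) :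
    dotProduct c (cubCross ![u, v, w]) =
      c 0 * (u 1 * (v 2 * w 3 - v 3 * w 2) + v 1 * (w 2 * u 3 - w 3 * u 2) + w 1 * (u 2 * v 3 - u 3 * v 2))
      - c 1 * (u 0 * (v 2 * w 3 - v 3 * w 2) + v 0 * (w 2 * u 3 - w 3 * u 2) + w 0 * (u 2 * v 3 - u 3 * v 2))
      + c 2 * (u 0 * (v 1 * w 3 - v 3 * w 1) + v 0 * (w 1 * u 3 - w 3 * u 1) + w 0 * (u 1 * v 3 - u 3 * v 1))
      - c 3 * (u 0 * (v 1 * w 2 - v 2 * w 1) + v 0 * (w 1 * u 2 - w 2 * u 1) + w 0 * (u 1 * v 2 - u 2 * v 1)) := by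
  simp [dotProduct, Fin.sum_univ_four, cubCross, colDet]
  ring

lemma linearIndependent_of_dotProduct {ι κ : Type*} [Fintype ι] [Fintype κ]
    {u v : ι → κ → ℤ} (h0 : ∀ i j, i ≠ j → dotProduct (u i) (v j) = 0)
    (h1 : ∀ i, dotProduct (u i) (v i) ≠ 0) : LinearIndependent ℤ v := by
  classical
  rw [Fintype.linearIndependent_iff]
  intro g hg i
  have h := congrArg (dotProduct (u i)) hg
  rw [dotProduct_sum, dotProduct_zero, Finset.sum_eq_single i] at h
  · rw [dotProduct_smul, smul_eq_mul] at h
    exact (mul_eq_zero.mp h).resolve_right (h1 i)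
  · intro j _ hj
    rw [dotProduct_smul, h0 i j hj.symm, smul_zero]
  · simp

/-- The four vectors of minors attached to four vectors in dimension `4`. -/
def cubDual (V : Fin 4 → Fin 4 → ℤ) : Fin 4 → Fin 4 → ℤ :=
  ![cubCross ![V 1, V 2, V 3], cubCross ![V 0, V 2, V 3], cubCross ![V 0, V 1, V 3],
    cubCross ![V 0, V 1, V 2]]

lemma dotProduct_cubDual_of_ne (V : Fin 4 → Fin 4 → ℤ) (i j : Fin 4) (h : i ≠ j) :
    dotProduct (V i) (cubDual V j) = 0 := by
  fin_cases i <;> fin_cases j <;> first | exact absurd rfl h | skip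
  all_goals
    simp only [cubDual, Fin.zero_eta, Fin.mk_one, Fin.reduceFinMk, Matrix.cons_val]
    rw [dotProduct_cubCross]
    ring

lemma dotProduct_cubDual_ne_zero {V : Fin 4 → Fin 4 → ℤ}
    (h : dotProduct (V 0) (cubDual V 0) ≠ 0) (i : Fin 4) :
    dotProduct (V i) (cubDual V i) ≠ 0 := by
  have key : dotProduct (V i) (cubDual V i) = dotProduct (V 0) (cubDual V 0) ∨
      dotProduct (V i) (cubDual V i) = -dotProduct (V 0) (cubDual V 0) := by
    fin_cases i
    · left; rfl
    · right
      simp only [cubDual, Fin.mk_one, Matrix.cons_val, dotProduct_cubCross]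
      ring
    · left
      simp only [cubDual, Fin.reduceFinMk, Matrix.cons_val, dotProduct_cubCross]
      ring
    · right
      simp only [cubDual, Fin.reduceFinMk, Matrix.cons_val, dotProduct_cubCross]
      ring
  rcases key with h' | h' <;> rw [h']
  · exact h
  · exact neg_ne_zero.mpr h

lemma linearIndependent_cubDual {V : Fin 4 → Fin 4 → ℤ}
    (h : dotProduct (V 0) (cubDual V 0) ≠ 0) : LinearIndependent ℤ (cubDual V) :=
  linearIndependent_of_dotProduct (dotProduct_cubDual_of_ne V) (dotProduct_cubDual_ne_zero h)

lemma linearIndependent_of_cubDual {V : Fin 4 → Fin 4 → ℤ}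
    (h : dotProduct (V 0) (cubDual V 0) ≠ 0) : LinearIndependent ℤ V :=
  linearIndependent_of_dotProduct (u := cubDual V)
    (fun i j hij => by rw [dotProduct_comm]; exact dotProduct_cubDual_of_ne V j i hij.symm)
    fun i => by rw [dotProduct_comm]; exact dotProduct_cubDual_ne_zero h i

lemma dotProduct_cubDual_lin (q p q' p' : ℤ) (Q R : Fin 3 → ℤ) (hpq : p * q' - p' * q ≠ 0)
    (hres : quadRes Q R ≠ 0) :
    let V := ![cubLin q p Q, cubLin q' p' Q, cubOfQuad R, cubShift R]
    dotProduct (V 0) (cubDual V 0) ≠ 0 := by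
  intro V
  have e : dotProduct (V 0) (cubDual V 0) = (p' * q - p * q') * quadRes Q R := by
    simp only [V, cubDual, Matrix.cons_val, dotProduct_cubCross, cubLin, cubOfQuad, cubShift, quadRes]
    ring
  rw [e]
  exact mul_ne_zero (by intro h; exact hpq (by linarith)) hres

lemma dotProduct_cubDual_quad (Q R : Fin 3 → ℤ) (hres : quadRes Q R ≠ 0) :
    let V := ![cubOfQuad Q, cubShift Q, cubOfQuad R, cubShift R]
    dotProduct (V 0) (cubDual V 0) ≠ 0 := by
  intro V
  have e : dotProduct (V 0) (cubDual V 0) = quadRes Q R := by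
    simp only [V, cubDual, Matrix.cons_val, dotProduct_cubCross, cubOfQuad, cubShift, quadRes]
    ring
  rwa [e]

lemma cubEval_cubOfQuad (ζ : ℝ) (Q : Fin 3 → ℤ) : cubEval ζ (cubOfQuad Q) = quadEval ζ Q := by
  simp [cubEval, cubOfQuad, quadEval]

lemma cubEval_cubShift (ζ : ℝ) (Q : Fin 3 → ℤ) : cubEval ζ (cubShift Q) = ζ * quadEval ζ Q := by
  simp [cubEval, cubShift, quadEval]; ring

lemma cubEval_cubLin (ζ : ℝ) (q p : ℤ) (Q : Fin 3 → ℤ) :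
    cubEval ζ (cubLin q p Q) = (q * ζ - p) * quadEval ζ Q := by
  simp [cubEval, cubLin, quadEval]; ring

lemma norm_cubOfQuad_le (Q : Fin 3 → ℤ) : ‖cubOfQuad Q‖ ≤ ‖Q‖ := by
  rw [pi_norm_le_iff_of_nonneg (norm_nonneg _)]
  intro i
  fin_cases i <;> simp [cubOfQuad, norm_le_pi_norm]

lemma norm_cubShift_le (Q : Fin 3 → ℤ) : ‖cubShift Q‖ ≤ ‖Q‖ := by
  rw [pi_norm_le_iff_of_nonneg (norm_nonneg _)]
  intro i
  fin_cases i <;> simp [cubShift, norm_le_pi_norm]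

lemma norm_cubLin_le (q p : ℤ) (Q : Fin 3 → ℤ) :
    ‖cubLin q p Q‖ ≤ (|(q : ℝ)| + |(p : ℝ)|) * ‖Q‖ := by
  have hQ := abs_apply_le_norm Q
  have hQ0 := norm_nonneg Q
  have hq := abs_nonneg (q : ℝ)
  have hp := abs_nonneg (p : ℝ)
  have h1 := mul_nonneg hq hQ0
  have h2 := mul_nonneg hp hQ0
  rw [pi_norm_le_iff_of_nonneg (by positivity), add_mul]
  intro i
  rw [Int.norm_eq_abs]
  fin_cases i
  · have : |(p : ℝ)| * |(Q 0 : ℝ)| ≤ |(p : ℝ)| * ‖Q‖ := by gcongr; exact hQ 0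
    simp [cubLin, abs_mul]
    linarith
  · simp [cubLin]
    exact abs_mul_sub_mul_le le_rfl (hQ 0) le_rfl (hQ 1)
  · simp [cubLin]
    exact abs_mul_sub_mul_le le_rfl (hQ 1) le_rfl (hQ 2)
  · have : |(q : ℝ)| * |(Q 2 : ℝ)| ≤ |(q : ℝ)| * ‖Q‖ := by gcongr; exact hQ 2
    simp [cubLin, abs_mul]
    linarith

/-- The cubic polynomial with coefficient vector `c` has height at most `exp a` and takes at `ζ` a
value of modulus at most `exp b`. -/
def CubBound (ζ a b : ℝ) (c : Fin 4 → ℤ) : Prop := ‖c‖ ≤ exp a ∧ |cubEval ζ c| ≤ exp b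

/-- The integer point `z` has first coordinate at most `exp a` and approximates
`(1, ζ, ζ ^ 2, ζ ^ 3)` up to `exp b`. -/
def PtBound (ζ a b : ℝ) (z : Fin 4 → ℤ) : Prop :=
  |(z 0 : ℝ)| ≤ exp a ∧ ∀ t : Fin 3, |ζ ^ ((t : ℕ) + 1) * z 0 - z t.succ| ≤ exp b

/-- There are `j` independent cubic polynomials of height at most `exp x` with values at most
`exp (-s * x)`. -/
def PolyFam (ζ s x : ℝ) (j : ℕ) : Prop :=
  ∃ c : Fin j → Fin 4 → ℤ, LinearIndependent ℤ c ∧ ∀ i, CubBound ζ x (-s * x) (c i)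

/-- There are `j` independent integer points of size at most `exp x` which approximate
`(1, ζ, ζ ^ 2, ζ ^ 3)` up to `exp (-s * x)`. -/
def PtFam (ζ s x : ℝ) (j : ℕ) : Prop :=
  ∃ z : Fin j → Fin 4 → ℤ, LinearIndependent ℤ z ∧ ∀ i, PtBound ζ x (-s * x) (z i)

section bounds

variable {ζ a b a' b' : ℝ}

lemma CubBound.mono {c : Fin 4 → ℤ} (h : CubBound ζ a b c) (ha : a ≤ a') (hb : b ≤ b') :
    CubBound ζ a' b' c :=
  ⟨h.1.trans (Real.exp_le_exp.mpr ha), h.2.trans (Real.exp_le_exp.mpr hb)⟩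

lemma PtBound.mono {z : Fin 4 → ℤ} (h : PtBound ζ a b z) (ha : a ≤ a') (hb : b ≤ b') :
    PtBound ζ a' b' z :=
  ⟨h.1.trans (Real.exp_le_exp.mpr ha), fun t => (h.2 t).trans (Real.exp_le_exp.mpr hb)⟩

lemma ptBound_cubCross {a₀ a₁ a₂ b₀ b₁ b₂ T W : ℝ} {u v w : Fin 4 → ℤ}
    (hu : CubBound ζ a₀ b₀ u) (hv : CubBound ζ a₁ b₁ v) (hw : CubBound ζ a₂ b₂ w)
    (hW : log 6 + a₀ + a₁ + a₂ ≤ W) (hT0 : log 6 + b₀ + a₁ + a₂ ≤ T)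
    (hT1 : log 6 + b₁ + a₀ + a₂ ≤ T) (hT2 : log 6 + b₂ + a₀ + a₁ ≤ T) :
    PtBound ζ W T (cubCross ![u, v, w]) := by
  refine cubCross_bounds (a := ![a₀, a₁, a₂]) (b := ![b₀, b₁, b₂]) ?_ ?_ hW hT0 hT1 hT2
  · intro i
    fin_cases i
    exacts [hu.1, hv.1, hw.1]
  · intro i
    fin_cases i
    exacts [hu.2, hv.2, hw.2]

lemma log_two_add_abs_nonneg (ζ : ℝ) : 0 ≤ log (2 + |ζ|) :=
  Real.log_nonneg (by linarith [abs_nonneg ζ])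

lemma exp_log_two_add_abs (ζ : ℝ) : exp (log (2 + |ζ|)) = 2 + |ζ| :=
  Real.exp_log (by linarith [abs_nonneg ζ])

lemma cubBound_cubOfQuad {Q : Fin 3 → ℤ} (ha : ‖Q‖ ≤ exp a) (hb : |quadEval ζ Q| ≤ exp b) :
    CubBound ζ a (log (2 + |ζ|) + b) (cubOfQuad Q) := by
  refine ⟨(norm_cubOfQuad_le Q).trans ha, ?_⟩
  rw [cubEval_cubOfQuad]
  exact hb.trans (Real.exp_le_exp.mpr (by linarith [log_two_add_abs_nonneg ζ]))

lemma cubBound_cubShift {Q : Fin 3 → ℤ} (ha : ‖Q‖ ≤ exp a) (hb : |quadEval ζ Q| ≤ exp b) :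
    CubBound ζ a (log (2 + |ζ|) + b) (cubShift Q) := by
  refine ⟨(norm_cubShift_le Q).trans ha, ?_⟩
  rw [cubEval_cubShift, abs_mul, Real.exp_add, exp_log_two_add_abs]
  have := abs_nonneg ζ
  gcongr
  linarith

lemma cubBound_cubLin {Q : Fin 3 → ℤ} {q p : ℤ} {β e : ℝ} (hβ : 0 ≤ β) (he : e ≤ 0)
    (hq : |(q : ℝ)| ≤ exp β) (hp : |q * ζ - p| ≤ exp e)
    (ha : ‖Q‖ ≤ exp a) (hb : |quadEval ζ Q| ≤ exp b) :
    CubBound ζ (log (2 + |ζ|) + β + a) (e + b) (cubLin q p Q) := by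
  constructor
  · refine (norm_cubLin_le q p Q).trans ?_
    rw [Real.exp_add, Real.exp_add, exp_log_two_add_abs]
    have h1 : (1 : ℝ) ≤ exp β := Real.one_le_exp hβ
    have h2 : exp e ≤ 1 := Real.exp_le_one_iff.mpr he
    have h3 : |(p : ℝ)| ≤ |(q : ℝ)| * |ζ| + 1 := by
      rw [← abs_mul]
      have := abs_sub_abs_le_abs_sub (p : ℝ) (q * ζ)
      rw [abs_sub_comm] at this
      linarith
    have h4 : |(q : ℝ)| * |ζ| ≤ exp β * |ζ| := by gcongr
    gcongr
    linarith
  · rw [cubEval_cubLin, abs_mul, Real.exp_add]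
    gcongr

end bounds

lemma exists_isQuadChain_lin {ζ : ℝ} (hζ : IsExtremal ζ) {δ : ℝ} (hδ : 0 < δ) (hδ1 : δ ≤ 1 / 100) :
    ∃ Q, IsQuadChain ζ δ Q ∧ (∀ m, 2 * log (2 + |ζ|) + log 6 ≤ δ * log ‖Q m‖) ∧
      (∀ m, 0 < log ‖Q m‖) ∧
      ∀ m k β, δ * log ‖Q k‖ ≤ β → ∃ q p q' p' : ℤ, p * q' - p' * q ≠ 0 ∧
        CubBound ζ (log (2 + |ζ|) + β + log ‖Q m‖)
          (-(1 - δ) * β + -(goldenRatio + 1 - δ) * log ‖Q (m + 1)‖) (cubLin q p (Q m)) ∧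
        CubBound ζ (log (2 + |ζ|) + β + log ‖Q m‖)
          (-(1 - δ) * β + -(goldenRatio + 1 - δ) * log ‖Q (m + 1)‖) (cubLin q' p' (Q m)) := by
  obtain ⟨β₀, hβ₀⟩ := exists_pairs hζ hδ (by linarith)
  have hκ := log_two_add_abs_nonneg ζ
  have h6 : 0 < log 6 := Real.log_pos (by norm_num)
  obtain ⟨Q, hQ, hY⟩ := exists_isQuadChain_le hζ hδ (by linarith)
    ((2 * log (2 + |ζ|) + log 6 + |β₀|) / δ)
  have hY' : ∀ m, 2 * log (2 + |ζ|) + log 6 + |β₀| ≤ δ * log ‖Q m‖ := fun m => by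
    have := hY m
    rw [div_le_iff₀ hδ] at this
    linarith
  have hb := abs_nonneg β₀
  have hb' := le_abs_self β₀
  refine ⟨Q, hQ, fun m => by linarith [hY' m], fun m => ?_, fun m k β hβ => ?_⟩
  · refine lt_of_lt_of_le ?_ (hY m)
    positivity
  · have := hY' k
    have hβ0 : 0 ≤ β := by linarith
    have he : -(1 - δ) * β ≤ 0 := by nlinarith
    obtain ⟨q, p, q', p', h1, h2, h3, h4, h5⟩ := hβ₀ β (by linarith)
    exact ⟨q, p, q', p', h5,
      cubBound_cubLin hβ0 he h1 h3 (hQ.norm_eq_exp m).le (hQ.eval_le_exp m),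
      cubBound_cubLin hβ0 he h2 h4 (hQ.norm_eq_exp m).le (hQ.eval_le_exp m)⟩

/-- A convenient choice of the small parameter attached to `ε`. -/
lemma exists_small {ε : ℝ} (hε : 0 < ε) : ∃ δ : ℝ, 0 < δ ∧ δ ≤ 1 / 100 ∧ 10 * δ ≤ ε :=
  ⟨min (1 / 100) (ε / 10), by positivity, min_le_left _ _,
    by linarith [min_le_right (1 / 100) (ε / 10)]⟩

lemma lin_exponent_le {g δ x y z : ℝ} (hδ : 0 < δ) (hδ1 : δ ≤ 1 / 100) (hg : 1.6 < g)
    (hx : 0 ≤ x) (h1 : y ≤ (g - 1 + δ) * z) (h2 : (1 - 2 * δ) * x ≤ z) :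
    -(1 - δ) * (x - y - δ * x) + -(g + 1 - δ) * z ≤ -(3 - 8 * δ) * x := by
  have e1 : (1 - δ) * y ≤ (1 - δ) * ((g - 1 + δ) * z) :=
    mul_le_mul_of_nonneg_left h1 (by linarith)
  have hz : 0 ≤ z := le_trans (mul_nonneg (by linarith) hx) h2
  have e2 : (2 - 2 * δ) * ((1 - 2 * δ) * x) ≤ (2 - 2 * δ) * z :=
    mul_le_mul_of_nonneg_left h2 (by linarith)
  have e3 : 0 ≤ δ * (g - 1 + δ) * z := by
    have : 0 ≤ g - 1 + δ := by linarith
    positivity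
  have e4 : 0 ≤ δ ^ 2 * x := by positivity
  linarith

lemma exists_polyFam_two {ζ : ℝ} (hζ : IsExtremal ζ) {ε : ℝ} (hε : 0 < ε) :
    ∃ x₀, ∀ x ≥ x₀, PolyFam ζ (3 - ε) x 2 := by
  obtain ⟨δ, hδ, hδ1, hδε⟩ := exists_small hε
  obtain ⟨Q, hQ, hK, hpos, hlin⟩ := exists_isQuadChain_lin hζ hδ hδ1
  have hκ := log_two_add_abs_nonneg ζ
  have h6 : 0 < log 6 := Real.log_pos (by norm_num)
  have hg1 := goldenRatio_gt
  refine ⟨log ‖Q 0‖ / (1 - 2 * δ), fun x hx => ?_⟩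
  rw [ge_iff_le, div_le_iff₀ (by linarith)] at hx
  have hx0 : 0 < x := by
    have := hpos 0
    by_contra! h
    nlinarith
  obtain ⟨m, hm1, hm2⟩ := exists_le_lt_succ hQ.tendsto (t := (1 - 2 * δ) * x) (by linarith)
  have hyx : log ‖Q m‖ ≤ x := by
    have : 0 < δ * x := by positivity
    linarith
  have hδx : δ * log ‖Q m‖ ≤ δ * x := mul_le_mul_of_nonneg_left hyx hδ.le
  obtain ⟨q, p, q', p', hpq, hA, hA'⟩ := hlin m m (x - log ‖Q m‖ - δ * x) (by linarith)
  have hexp := lin_exponent_le hδ hδ1 hg1 hx0.le (hQ.log_le_mul_succ hδ (by linarith) m) hm2.le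
  have hind := linearIndependent_of_cubDual
    (dotProduct_cubDual_lin q p q' p' (Q m) (Q (m + 1)) hpq (hQ.quadRes_ne_zero m))
  have hεx : 10 * δ * x ≤ ε * x := by gcongr
  have hmx := hK m
  refine ⟨_, hind.comp (Fin.castLE (by norm_num : 2 ≤ 4)) (Fin.castLE_injective _), fun i => ?_⟩
  fin_cases i
  · exact hA.mono (by linarith) (by nlinarith)
  · exact hA'.mono (by linarith) (by nlinarith)

lemma exists_four_cubBound {ζ : ℝ} (hζ : IsExtremal ζ) {δ : ℝ} (hδ : 0 < δ) (hδ1 : δ ≤ 1 / 100)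
    (x₀ : ℝ) : ∃ x ≥ x₀, 0 < x ∧ log 6 ≤ δ * x ∧ ∃ V : Fin 4 → Fin 4 → ℤ,
      dotProduct (V 0) (cubDual V 0) ≠ 0 ∧ ∀ i, CubBound ζ x (-(3 - 8 * δ) * x) (V i) := by
  obtain ⟨Q, hQ, hK, hpos, hlin⟩ := exists_isQuadChain_lin hζ hδ hδ1
  have hκ := log_two_add_abs_nonneg ζ
  have h6 : 0 < log 6 := Real.log_pos (by norm_num)
  have hg1 := goldenRatio_gt
  obtain ⟨m, hm⟩ := (hQ.tendsto.eventually (Filter.eventually_ge_atTop x₀)).exists_forall_of_atTop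
  have hm1 := hm (m + 1) (by omega)
  set y := log ‖Q (m + 1)‖ with hy
  have hy0 : 0 < y := hpos (m + 1)
  set x := y / (1 - 2 * δ) with hxdef
  have hd : 0 < 1 - 2 * δ := by linarith
  have hxy : (1 - 2 * δ) * x = y := by rw [hxdef]; field_simp
  have hx0 : 0 < x := by positivity
  have hδx0 : 0 < δ * x := by positivity
  have hyx : y ≤ x := by linarith
  have hym : log ‖Q m‖ ≤ y := Real.log_le_log (norm_pos_iff.mpr (hQ.ne_zero m)) (hQ.norm_lt m).le
  have hδx : δ * y ≤ δ * x := mul_le_mul_of_nonneg_left hyx hδ.le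
  have hKx := hK (m + 1)
  have hδm : δ * log ‖Q m‖ ≤ δ * y := mul_le_mul_of_nonneg_left hym hδ.le
  obtain ⟨q, p, q', p', hpq, hA, hA'⟩ := hlin m m (x - log ‖Q m‖ - δ * x) (by linarith)
  have hexp := lin_exponent_le hδ hδ1 hg1 hx0.le (hQ.log_le_mul_succ hδ (by linarith) m) hxy.le
  have hR1 := (hQ.norm_eq_exp (m + 1)).le
  have hR2 := hQ.eval_le_exp (m + 1)
  have hz := hQ.le_log (m + 1)
  have hb : log (2 + |ζ|) + -(goldenRatio + 1 - δ) * log ‖Q (m + 1 + 1)‖ ≤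
      -(3 - 8 * δ) * x := by
    have h1 : 1.59 * y ≤ log ‖Q (m + 1 + 1)‖ := le_trans (by gcongr; linarith) hz
    have h2 : 2.59 * log ‖Q (m + 1 + 1)‖ ≤ (goldenRatio + 1 - δ) * log ‖Q (m + 1 + 1)‖ := by
      gcongr
      · exact (hpos _).le
      · linarith
    have h3 : δ * x ≤ 1 / 100 * x := by gcongr
    linarith
  refine ⟨x, by linarith, hx0, by linarith, _,
    dotProduct_cubDual_lin q p q' p' (Q m) (Q (m + 1)) hpq (hQ.quadRes_ne_zero m), fun i => ?_⟩
  fin_cases i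
  · exact hA.mono (by linarith) hexp
  · exact hA'.mono (by linarith) hexp
  · exact (cubBound_cubOfQuad hR1 hR2).mono hyx hb
  · exact (cubBound_cubShift hR1 hR2).mono hyx hb

lemma exists_polyFam_four {ζ : ℝ} (hζ : IsExtremal ζ) {ε : ℝ} (hε : 0 < ε) (x₀ : ℝ) :
    ∃ x ≥ x₀, PolyFam ζ (3 - ε) x 4 := by
  obtain ⟨δ, hδ, hδ1, hδε⟩ := exists_small hε
  obtain ⟨x, hx, hx0, -, V, hV, hb⟩ := exists_four_cubBound hζ hδ hδ1 x₀
  refine ⟨x, hx, V, linearIndependent_of_cubDual hV, fun i => (hb i).mono le_rfl ?_⟩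
  gcongr
  linarith

lemma exists_ptFam_four {ζ : ℝ} (hζ : IsExtremal ζ) {ε : ℝ} (hε : 0 < ε) (x₀ : ℝ) :
    ∃ x ≥ x₀, PtFam ζ (1 / 3 - ε) x 4 := by
  obtain ⟨δ, hδ, hδ1, hδε⟩ := exists_small hε
  obtain ⟨x, hx, hx0, h6, V, hV, hb⟩ := exists_four_cubBound hζ hδ hδ1 x₀
  have hδx : 0 < δ * x := by positivity
  have hεx : 10 * δ * x ≤ ε * x := by gcongr
  have hεδ : 0 < ε * δ * x := by positivity
  refine ⟨(3 + δ) * x, by linarith, cubDual V, linearIndependent_cubDual hV, fun i => ?_⟩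
  have key : ∀ i j k, PtBound ζ ((3 + δ) * x) (-(1 / 3 - ε) * ((3 + δ) * x))
      (cubCross ![V i, V j, V k]) := fun i j k =>
    ptBound_cubCross (hb i) (hb j) (hb k) (by linarith) (by linarith) (by linarith) (by linarith)
  fin_cases i
  exacts [key 1 2 3, key 0 2 3, key 0 1 3, key 0 1 2]

lemma exists_ptFam_two {ζ : ℝ} (hζ : IsExtremal ζ) {ε : ℝ} (hε : 0 < ε) :
    ∃ x₀, ∀ x ≥ x₀, PtFam ζ (1 / 3 - ε) x 2 := by
  obtain ⟨δ, hδ, hδ1, hδε⟩ := exists_small hε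
  obtain ⟨Q, hQ, hK, hpos, hlin⟩ := exists_isQuadChain_lin hζ hδ hδ1
  have hκ := log_two_add_abs_nonneg ζ
  have h6 : 0 < log 6 := Real.log_pos (by norm_num)
  have hg1 := goldenRatio_gt
  have hg2 := goldenRatio_lt
  have hT : Filter.Tendsto (fun m => 3 * (1 + δ) * log ‖Q (m + 1)‖) Filter.atTop Filter.atTop :=
    ((Filter.tendsto_add_atTop_iff_nat 1).mpr hQ.tendsto).const_mul_atTop (by linarith)
  refine ⟨3 * (1 + δ) * log ‖Q (0 + 1)‖, fun w hw => ?_⟩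
  obtain ⟨m, hm1, hm2⟩ := exists_le_lt_succ hT (t := w) hw
  have hK1 := hK (m + 1)
  have hx0 := hQ.log_le_mul_succ hδ (by linarith) m
  have hx1 := hQ.log_le_mul_succ hδ (by linarith) (m + 1)
  have hz1 := hQ.le_log (m + 1)
  have hz2 := hQ.log_le (m + 1)
  have hz3 := hQ.le_log (m + 2)
  have hR1 := (hQ.norm_eq_exp (m + 1)).le
  have hR2 := hQ.eval_le_exp (m + 1)
  have hS1 := (hQ.norm_eq_exp (m + 2)).le
  have hS2 := hQ.eval_le_exp (m + 2)
  have hy := hpos (m + 1)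
  have hz := hpos (m + 2)
  have hz' := hpos (m + 3)
  simp only [add_assoc, Nat.reduceAdd] at hm1 hm2 hx1 hz1 hz2 hz3 hR2 hS2
  set y₀ := log ‖Q m‖
  set y := log ‖Q (m + 1)‖ with hydef
  set z := log ‖Q (m + 2)‖
  set z' := log ‖Q (m + 3)‖
  have hδy : 0 < δ * y := by positivity
  have hw0 : 3 * y ≤ w := by linarith
  have hwpos : 0 < w := by linarith
  have hδw : 3 * (δ * y) ≤ δ * w := by nlinarith
  have hδw1 : δ * w ≤ 1 / 100 * w := by gcongr
  have hδy1 : δ * y ≤ 1 / 100 * y := by gcongr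
  have hεw : 10 * δ * w ≤ ε * w := by gcongr
  have hzl : 1.59 * y ≤ z := le_trans (by gcongr; linarith) hz1
  have hzu : z ≤ 1.66 * y := hz2.trans (by gcongr; linarith)
  have hzg : 2.59 * z ≤ (goldenRatio + 1 - δ) * z := by gcongr; linarith
  by_cases hcase : w ≤ 3.8 * y
  · set β := w - (goldenRatio + 1 + 2 * δ) * y - δ * w with hβ
    have hgy : goldenRatio * y ≤ 1.65 * y := by gcongr
    obtain ⟨q, p, q', p', hpq, hA, hA'⟩ := hlin m (m + 1) β (by linarith)
    have hV := linearIndependent_cubDual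
      (dotProduct_cubDual_lin q p q' p' (Q m) (Q (m + 1)) hpq (hQ.quadRes_ne_zero m))
    have hE := cubBound_cubOfQuad hR1 hR2
    have hS := cubBound_cubShift hR1 hR2
    have hδδ : 0 ≤ δ * ((goldenRatio + 1 + 2 * δ) * y) := by
      have : 0 ≤ goldenRatio + 1 + 2 * δ := by linarith
      positivity
    have hδδw : 0 ≤ δ * (δ * w) := by positivity
    have key : ∀ A : Fin 4 → ℤ, CubBound ζ (log (2 + |ζ|) + β + y₀)
        (-(1 - δ) * β + -(goldenRatio + 1 - δ) * y) A →
        PtBound ζ w (-(1 / 3 - ε) * w) (cubCross ![A, cubOfQuad (Q (m + 1)),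
          cubShift (Q (m + 1))]) := by
      intro A hA
      have hT1 : log 6 + (log (2 + |ζ|) + -(goldenRatio + 1 - δ) * z) +
          (log (2 + |ζ|) + β + y₀) + y ≤ -(1 / 3 - ε) * w := by linarith
      refine ptBound_cubCross hA hE hS ?_ ?_ hT1 hT1
      · linarith
      · have e : -(1 - δ) * β + -(goldenRatio + 1 - δ) * y = -(1 - δ) * (w - δ * w) +
            3 * (δ * y) - δ * ((goldenRatio + 1 + 2 * δ) * y) := by rw [hβ]; ring
        rw [e]
        linarith
    refine ⟨_, hV.comp (Fin.castLE (by norm_num : 2 ≤ 4)) (Fin.castLE_injective _), fun i => ?_⟩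
    fin_cases i
    exacts [key _ hA', key _ hA]
  · push Not at hcase
    have hV := linearIndependent_cubDual
      (dotProduct_cubDual_quad (Q (m + 1)) (Q (m + 2)) (hQ.quadRes_ne_zero (m + 1)))
    have hz'l : 1.59 * z ≤ z' := le_trans (by gcongr; linarith) hz3
    have hzg' : 2.59 * z' ≤ (goldenRatio + 1 - δ) * z' := by gcongr; linarith
    have hδz : δ * z ≤ 1 / 100 * z := by gcongr
    have hwz : -(1 - 2 * δ) * z ≤ -(1 / 3) * w + δ * w := by
      have h1 : (1 - 2 * δ) * w ≤ (1 - 2 * δ) * (3 * (1 + δ) * z) :=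
        mul_le_mul_of_nonneg_left hm2.le (by linarith)
      have h2 : 0 ≤ δ * z := by positivity
      nlinarith
    have key : ∀ A : Fin 4 → ℤ, CubBound ζ z
        (log (2 + |ζ|) + -(goldenRatio + 1 - δ) * z') A →
        PtBound ζ w (-(1 / 3 - ε) * w) (cubCross ![cubOfQuad (Q (m + 1)),
          cubShift (Q (m + 1)), A]) := by
      intro A hA
      have hT1 : log 6 + (log (2 + |ζ|) + -(goldenRatio + 1 - δ) * z) + y + z ≤
          -(1 / 3 - ε) * w := by linarith
      refine ptBound_cubCross (cubBound_cubOfQuad hR1 hR2) (cubBound_cubShift hR1 hR2) hA ?_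
        hT1 hT1 ?_
      · linarith
      · linarith
    refine ⟨_, hV.comp (Fin.natAdd 2) (Fin.natAdd_injective 2 2), fun i => ?_⟩
    fin_cases i
    exacts [key _ (cubBound_cubShift hS1 hS2), key _ (cubBound_cubOfQuad hS1 hS2)]

lemma rank_map_of_linearIndependent {ι μ : Type*} [Fintype ι] [Fintype μ]
    {A : Matrix ι μ ℤ} (h : LinearIndependent ℤ A.row) :
    (A.map (algebraMap ℤ ℚ)).rank = Fintype.card ι :=
  LinearIndependent.rank_matrix
    ((linearIndependent_algebraMap_comp_iff (R := ℤ) (S := ℚ) (v := A.row)).mpr h)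

lemma card_add_card_le_of_dotProduct_eq_zero {ι κ μ : Type*} [Fintype ι] [Fintype κ] [Fintype μ]
    {c : ι → μ → ℤ} {z : κ → μ → ℤ} (hc : LinearIndependent ℤ c) (hz : LinearIndependent ℤ z)
    (h : ∀ i k, dotProduct (c i) (z k) = 0) :
    Fintype.card ι + Fintype.card κ ≤ Fintype.card μ := by
  have hA := rank_map_of_linearIndependent (A := Matrix.of c) hc
  have hB := rank_map_of_linearIndependent (A := Matrix.of z) hz
  have hAB : Matrix.of c * (Matrix.of z).transpose = 0 := Matrix.ext h
  have hABQ := congrArg (fun M : Matrix ι κ ℤ => M.map (algebraMap ℤ ℚ)) hAB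
  simp only [Matrix.map_mul, Matrix.transpose_map, Matrix.map_zero _ (map_zero _)] at hABQ
  have := Matrix.rank_add_rank_le_card_of_mul_eq_zero hABQ
  rwa [Matrix.rank_transpose, hA, hB] at this

lemma PolyFam.add_le_four {ζ s s' x w : ℝ} {j k : ℕ} (hc : PolyFam ζ s x j)
    (hz : PtFam ζ s' w k) (h1 : w + 2 ≤ s * x) (h2 : x + 2 ≤ s' * w) : j + k ≤ 4 := by
  obtain ⟨c, hcind, hc⟩ := hc
  obtain ⟨z, hzind, hz⟩ := hz
  have key : ∀ i k, dotProduct (c i) (z k) = 0 := by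
    intro i k
    have hb : ∀ t, |(c i t : ℝ)| ≤ exp x := fun t => (abs_apply_le_norm _ t).trans (hc i).1
    have e5 : 5 ≤ exp (2 : ℝ) := by
      have := Real.quadratic_le_exp_of_nonneg (x := 2) (by norm_num)
      linarith
    have hE : exp (-2 : ℝ) ≤ 1 / 5 := by
      rw [Real.exp_neg, ← one_div]
      exact one_div_le_one_div_of_le (by norm_num) e5
    have hp : |cubEval ζ (c i) * z k 0| ≤ 1 / 5 := by
      refine le_trans ?_ hE
      calc |cubEval ζ (c i) * z k 0| = |cubEval ζ (c i)| * |(z k 0 : ℝ)| := abs_mul _ _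
        _ ≤ exp (-s * x) * exp w := by
          gcongr
          · exact (hc i).2
          · exact (hz k).1
        _ = exp (-s * x + w) := (Real.exp_add _ _).symm
        _ ≤ _ := Real.exp_le_exp.mpr (by linarith)
    have hq : ∀ t : Fin 3, |(c i t.succ : ℝ) * (ζ ^ ((t : ℕ) + 1) * z k 0 - z k t.succ)| ≤
        1 / 5 := by
      intro t
      refine le_trans ?_ hE
      rw [abs_mul]
      calc _ ≤ exp x * exp (-s' * w) := by
            gcongr
            · exact hb _
            · exact (hz k).2 t
        _ = exp (x + -s' * w) := (Real.exp_add _ _).symm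
        _ ≤ _ := Real.exp_le_exp.mpr (by linarith)
    have e : ((dotProduct (c i) (z k) : ℤ) : ℝ) = cubEval ζ (c i) * z k 0 -
        ∑ t : Fin 3, (c i t.succ : ℝ) * (ζ ^ ((t : ℕ) + 1) * z k 0 - z k t.succ) := by
      simp [dotProduct, Fin.sum_univ_four, Fin.sum_univ_three, cubEval]
      ring
    rw [Fin.sum_univ_three] at e
    have hlt : |((dotProduct (c i) (z k) : ℤ) : ℝ)| < 1 := by
      have q0 := abs_le.mp (hq 0)
      have q1 := abs_le.mp (hq 1)
      have q2 := abs_le.mp (hq 2)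
      have p0 := abs_le.mp hp
      rw [e, abs_lt]
      constructor <;> linarith
    exact Int.abs_lt_one_iff.mp (by exact_mod_cast hlt)
  simpa using card_add_card_le_of_dotProduct_eq_zero hcind hzind key

lemma exists_slope {s s' : ℝ} (hs : 0 < s) (hs' : 0 < s') (h : 1 < s * s') :
    ∃ θ > 0, ∃ x₀, ∀ x ≥ x₀, θ * x + 2 ≤ s * x ∧ x + 2 ≤ s' * (θ * x) := by
  set θ := (s + 1 / s') / 2 with hθ
  have h1 : s' * θ = (s * s' + 1) / 2 := by rw [hθ]; field_simp
  have h2 : θ < s := by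
    have : s' * θ < s' * s := by linarith
    exact lt_of_mul_lt_mul_left this hs'.le
  refine ⟨θ, by positivity, max (2 / (s - θ)) (2 / (s' * θ - 1)), fun x hx => ?_⟩
  have e1 := (le_max_left _ _).trans hx
  have e2 := (le_max_right _ _).trans hx
  rw [div_le_iff₀ (by linarith)] at e1 e2
  constructor <;> linarith

lemma add_le_four_of_frequently_polyFam {ζ s s' : ℝ} {j k : ℕ} (hs : 0 < s) (hs' : 0 < s')
    (h : 1 < s * s') (hc : ∀ x₀, ∃ x ≥ x₀, PolyFam ζ s x j)
    (hz : ∃ x₀, ∀ x ≥ x₀, PtFam ζ s' x k) : j + k ≤ 4 := by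
  obtain ⟨θ, hθ, x₀, hx₀⟩ := exists_slope hs hs' h
  obtain ⟨w₀, hw₀⟩ := hz
  obtain ⟨x, hx, hP⟩ := hc (max x₀ (w₀ / θ))
  have hx1 := (le_max_left _ _).trans hx
  have hx2 := (le_max_right _ _).trans hx
  rw [div_le_iff₀ hθ] at hx2
  obtain ⟨h1, h2⟩ := hx₀ x hx1
  exact hP.add_le_four (hw₀ (θ * x) (by linarith)) h1 h2

lemma add_le_four_of_frequently_ptFam {ζ s s' : ℝ} {j k : ℕ} (hs : 0 < s) (hs' : 0 < s')
    (h : 1 < s * s') (hc : ∃ x₀, ∀ x ≥ x₀, PolyFam ζ s x j)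
    (hz : ∀ x₀, ∃ x ≥ x₀, PtFam ζ s' x k) : j + k ≤ 4 := by
  obtain ⟨θ, hθ, x₀, hx₀⟩ := exists_slope hs hs' h
  obtain ⟨x₁, hx₁⟩ := hc
  obtain ⟨w, hw, hP⟩ := hz (θ * max x₀ x₁)
  have hwx : max x₀ x₁ ≤ w / θ := by rw [le_div_iff₀ hθ]; linarith
  obtain ⟨h1, h2⟩ := hx₀ (w / θ) ((le_max_left _ _).trans hwx)
  rw [mul_div_cancel₀ _ hθ.ne'] at h1 h2
  exact (hx₁ (w / θ) ((le_max_right _ _).trans hwx)).add_le_four hP h1 h2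

lemma PolyFam.of_le {ζ s x : ℝ} {j k : ℕ} (h : PolyFam ζ s x k) (hjk : j ≤ k) :
    PolyFam ζ s x j := by
  obtain ⟨c, hc, hb⟩ := h
  exact ⟨_, hc.comp _ (Fin.castLE_injective hjk), fun i => hb _⟩

lemma PtFam.of_le {ζ s x : ℝ} {j k : ℕ} (h : PtFam ζ s x k) (hjk : j ≤ k) :
    PtFam ζ s x j := by
  obtain ⟨z, hz, hb⟩ := h
  exact ⟨_, hz.comp _ (Fin.castLE_injective hjk), fun i => hb _⟩

lemma rpow_neg_eq_exp {X : ℝ} (hX : 0 < X) (η : ℝ) : X ^ (-η) = exp (-η * log X) := by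
  rw [Real.rpow_def_of_pos hX, mul_comm]

lemma pev_eq_cubEval {ζ : ℝ} {P : ℤ[X]} (hP : P.natDegree ≤ 3) :
    pev ζ P = cubEval ζ (toFn 4 P) := by
  rw [pev, Polynomial.aeval_eq_sum_range' (n := 4) (by omega)]
  simp [Finset.sum_range_succ, cubEval, toFn]

lemma polyH_le_iff {P : ℤ[X]} (hP : P.natDegree ≤ 3) {X : ℝ} (hX : 0 ≤ X) :
    polyH P ≤ X ↔ ‖toFn 4 P‖ ≤ X := by
  rw [pi_norm_le_iff_of_nonneg hX]
  constructor
  · intro h i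
    rw [Int.norm_eq_abs]
    exact (abs_coeff_le_polyH P i).trans h
  · intro h
    rw [polyH, ← Nat.le_floor_iff hX, Finset.sup_le_iff]
    intro i hi
    have hi4 : i < 4 := by
      have := le_natDegree_of_mem_supp i hi
      omega
    have := h ⟨i, hi4⟩
    rw [Int.norm_eq_abs] at this
    rw [Nat.le_floor_iff hX, Nat.cast_natAbs]
    exact_mod_cast this

lemma linearIndependent_toFn_iff {ι : Type*} {P : ι → ℤ[X]} (hP : ∀ i, (P i).natDegree ≤ 3) :
    LinearIndependent ℤ (fun i => toFn 4 (P i)) ↔ LinearIndependent ℤ P := by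
  have e : ofFn 4 ∘ (fun i => toFn 4 (P i)) = P := funext fun i =>
    ofFn_comp_toFn_eq_id_of_natDegree_lt (by have := hP i; omega)
  conv_rhs => rw [← e]
  exact (LinearMap.linearIndependent_iff _
    (LinearMap.ker_eq_bot.mpr (injective_ofFn 4))).symm

lemma exists_poly_iff_polyFam {ζ : ℝ} (hζ : Transcendental ℚ ζ) {j : ℕ} {η X : ℝ} (hX : 0 < X) :
    (∃ P : Fin j → ℤ[X], LinearIndependent ℤ P ∧ ∀ i : Fin j,
      (P i).natDegree ≤ 3 ∧ polyH (P i) ≤ X ∧ 0 < |pev ζ (P i)| ∧ |pev ζ (P i)| ≤ X ^ (-η)) ↔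
    PolyFam ζ η (log X) j := by
  simp only [PolyFam, CubBound, Real.exp_log hX, rpow_neg_eq_exp hX]
  constructor
  · rintro ⟨P, hP, hb⟩
    refine ⟨_, (linearIndependent_toFn_iff fun i => (hb i).1).mpr hP, fun i => ?_⟩
    obtain ⟨h1, h2, -, h4⟩ := hb i
    exact ⟨(polyH_le_iff h1 hX.le).mp h2, pev_eq_cubEval (ζ := ζ) h1 ▸ h4⟩
  · rintro ⟨c, hc, hb⟩
    have hdeg : ∀ i, (ofFn 4 (c i)).natDegree ≤ 3 := fun i =>
      Nat.lt_succ_iff.mp (ofFn_natDegree_lt (by norm_num) _)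
    have hind : LinearIndependent ℤ fun i => ofFn 4 (c i) := by
      rw [← linearIndependent_toFn_iff hdeg]
      simpa only [toFn_comp_ofFn_eq_id] using hc
    refine ⟨_, hind, fun i => ⟨hdeg i, ?_, ?_, ?_⟩⟩
    · rw [polyH_le_iff (hdeg i) hX.le, toFn_comp_ofFn_eq_id]
      exact (hb i).1
    · rw [abs_pos, pev]
      intro h
      exact hind.ne_zero i (transcendental_iff.mp (hζ.restrictScalars (R := ℤ) Int.cast_injective) _ h)
    · rw [pev_eq_cubEval (hdeg i), toFn_comp_ofFn_eq_id]
      exact (hb i).2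

lemma exists_pt_iff_ptFam {ζ : ℝ} {j : ℕ} {η X : ℝ} (hX : 0 < X) :
    (∃ v : Fin j → (Fin (3 + 1) → ℤ), LinearIndependent ℤ v ∧ ∀ i : Fin j,
      ((|v i 0| : ℤ) : ℝ) ≤ X ∧ ∀ t : Fin 3,
        |ζ ^ ((t : ℕ) + 1) * ((v i 0 : ℤ) : ℝ) - ((v i t.succ : ℤ) : ℝ)| ≤ X ^ (-η)) ↔
    PtFam ζ η (log X) j := by
  simp only [PtFam, PtBound, Real.exp_log hX, rpow_neg_eq_exp hX, Int.cast_abs]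

lemma frequently_log_iff {p q : ℝ → Prop} (h : ∀ X > 0, p X ↔ q (log X)) :
    (∀ X₀ : ℝ, ∃ X, X₀ ≤ X ∧ p X) ↔ ∀ x₀ : ℝ, ∃ x ≥ x₀, q x := by
  constructor
  · intro hp x₀
    obtain ⟨X, hX, hpX⟩ := hp (exp x₀)
    have hX0 : 0 < X := (Real.exp_pos _).trans_le hX
    exact ⟨log X, (Real.le_log_iff_exp_le hX0).mpr hX, (h X hX0).mp hpX⟩
  · intro hq X₀
    obtain ⟨x, hx, hqx⟩ := hq X₀
    refine ⟨exp x, by linarith [Real.add_one_le_exp x], (h _ (Real.exp_pos x)).mpr ?_⟩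
    rwa [Real.log_exp]

lemma eventually_log_iff {p q : ℝ → Prop} (h : ∀ X > 0, p X ↔ q (log X)) :
    (∃ X₀ : ℝ, ∀ X, X₀ ≤ X → p X) ↔ ∃ x₀ : ℝ, ∀ x ≥ x₀, q x := by
  have := not_congr (frequently_log_iff (p := fun X => ¬ p X) (q := fun x => ¬ q x)
    fun X hX => not_congr (h X hX))
  push Not at this
  exact this

section mem

variable {ζ η : ℝ} {j : ℕ}

lemma mem_wSetJ_three_iff (hζ : Transcendental ℚ ζ) :
    η ∈ wSetJ 3 j ζ ↔ ∀ x₀ : ℝ, ∃ x ≥ x₀, PolyFam ζ η x j :=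
  frequently_log_iff fun _ => exists_poly_iff_polyFam hζ

lemma mem_whSetJ_three_iff (hζ : Transcendental ℚ ζ) :
    η ∈ whSetJ 3 j ζ ↔ ∃ x₀ : ℝ, ∀ x ≥ x₀, PolyFam ζ η x j :=
  eventually_log_iff fun _ => exists_poly_iff_polyFam hζ

lemma mem_lamSetJ_three_iff : η ∈ lamSetJ 3 j ζ ↔ ∀ x₀ : ℝ, ∃ x ≥ x₀, PtFam ζ η x j :=
  frequently_log_iff fun _ => exists_pt_iff_ptFam

lemma mem_lamhSetJ_three_iff : η ∈ lamhSetJ 3 j ζ ↔ ∃ x₀ : ℝ, ∀ x ≥ x₀, PtFam ζ η x j :=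
  eventually_log_iff fun _ => exists_pt_iff_ptFam

end mem

lemma csSup_eq_of_forall_sub_mem {S : Set ℝ} {c : ℝ} (h1 : ∀ η ∈ S, η ≤ c)
    (h2 : ∀ ε > 0, c - ε ∈ S) : sSup S = c :=
  csSup_eq_of_forall_le_of_forall_lt_exists_gt ⟨_, h2 1 one_pos⟩ h1
    fun w hw => ⟨_, h2 ((c - w) / 2) (by linarith), by linarith⟩

theorem extremal_minima_34 (ζ : ℝ) (hζ : IsExtremal ζ) :
    wExpJ 3 3 ζ = 3 ∧ wExpJ 3 4 ζ = 3 ∧ whExpJ 3 2 ζ = 3 ∧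
    lamExpJ 3 3 ζ = 1 / 3 ∧ lamExpJ 3 4 ζ = 1 / 3 ∧ lamhExpJ 3 2 ζ = 1 / 3 := by
  have ht := hζ.1
  have hw : ∀ η : ℝ, 3 < η → ∃ ε > 0, 0 < 1 / 3 - ε ∧ 1 < η * (1 / 3 - ε) := fun η hη => by
    have h0 : η ≠ 0 := by linarith
    have h1 : 0 < 1 / η := by positivity
    have h2 : 1 / η < 1 / 3 := one_div_lt_one_div_of_lt (by norm_num) hη
    have h3 : η * (1 / η) = 1 := by field_simp
    exact ⟨(1 / 3 - 1 / η) / 2, by linarith, by linarith, by linarith⟩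
  have hl : ∀ η : ℝ, 1 / 3 < η → ∃ ε > 0, 0 < 3 - ε ∧ 1 < (3 - ε) * η := fun η hη => by
    have h0 : η ≠ 0 := by linarith
    have hp : 0 < η := by linarith
    have h1 : 0 < 1 / η := by positivity
    have h3 : η * (1 / η) = 1 := by field_simp
    have h2 : 1 / η < 3 := by rw [div_lt_iff₀ hp]; linarith
    exact ⟨(3 - 1 / η) / 2, by linarith, by linarith, by linarith⟩
  have w34 : ∀ ε > 0, 3 - ε ∈ wSetJ 3 4 ζ := fun ε hε =>
    (mem_wSetJ_three_iff ht).mpr (exists_polyFam_four hζ hε)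
  have w43 : ∀ η, η ∈ wSetJ 3 4 ζ → η ∈ wSetJ 3 3 ζ := fun η h => by
    rw [mem_wSetJ_three_iff ht] at h ⊢
    exact fun x₀ => (h x₀).imp fun x hx => ⟨hx.1, hx.2.of_le (by norm_num)⟩
  have w33 : ∀ η ∈ wSetJ 3 3 ζ, η ≤ 3 := fun η h => by
    by_contra! hη
    obtain ⟨ε, hε, h1, h2⟩ := hw η hη
    have := add_le_four_of_frequently_polyFam (by linarith) h1 h2
      ((mem_wSetJ_three_iff ht).mp h) (exists_ptFam_two hζ hε)
    omega
  have l34 : ∀ ε > 0, 1 / 3 - ε ∈ lamSetJ 3 4 ζ := fun ε hε =>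
    mem_lamSetJ_three_iff.mpr (exists_ptFam_four hζ hε)
  have l43 : ∀ η, η ∈ lamSetJ 3 4 ζ → η ∈ lamSetJ 3 3 ζ := fun η h => by
    rw [mem_lamSetJ_three_iff] at h ⊢
    exact fun x₀ => (h x₀).imp fun x hx => ⟨hx.1, hx.2.of_le (by norm_num)⟩
  have l33 : ∀ η ∈ lamSetJ 3 3 ζ, η ≤ 1 / 3 := fun η h => by
    by_contra! hη
    obtain ⟨ε, hε, h1, h2⟩ := hl η hη
    have := add_le_four_of_frequently_ptFam h1 (by linarith) h2
      (exists_polyFam_two hζ hε) (mem_lamSetJ_three_iff.mp h)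
    omega
  refine ⟨csSup_eq_of_forall_sub_mem w33 fun ε hε => w43 _ (w34 ε hε),
    csSup_eq_of_forall_sub_mem (fun η h => w33 η (w43 η h)) w34,
    csSup_eq_of_forall_sub_mem (fun η h => ?_)
      fun ε hε => (mem_whSetJ_three_iff ht).mpr (exists_polyFam_two hζ hε),
    csSup_eq_of_forall_sub_mem l33 fun ε hε => l43 _ (l34 ε hε),
    csSup_eq_of_forall_sub_mem (fun η h => l33 η (l43 η h)) l34,
    csSup_eq_of_forall_sub_mem (fun η h => ?_)
      fun ε hε => mem_lamhSetJ_three_iff.mpr (exists_ptFam_two hζ hε)⟩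
  · by_contra! hη
    obtain ⟨ε, hε, h1, h2⟩ := hw η hη
    have := add_le_four_of_frequently_ptFam (by linarith) h1 h2
      ((mem_whSetJ_three_iff ht).mp h) (exists_ptFam_four hζ hε)
    omega
  · by_contra! hη
    obtain ⟨ε, hε, h1, h2⟩ := hl η hη
    have := add_le_four_of_frequently_polyFam h1 (by linarith) h2
      (exists_polyFam_four hζ hε) (mem_lamhSetJ_three_iff.mp h)
    omega
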